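/- arXiv:0807.0620 — 2 statements merged into one kernel-verified Lean document; each statement's English description precedes it below -/
import Mathlib

section
/- The indices A_{t_i} = [U(ℤ_p)·GL₂(ℤ_p) : G_{t_i}¹] are given by: A_{t₁} = p(p+1), A_{t₂} = p²(p+1), A_{t₃} = p²(p+1), A_{t₄} = p(p+1), A_{t₅} = p+1, A_{t₆} = p+1, A_{t₇} = p³(p+1), A_{t₈} = p³(p+1). -/
open Matrix

noncomputable section

variable (p : ℕ) [Fact p.Prime]

/-- The 4×4 symplectic similitude matrix `J`. -/
def Jmat : Matrix (Fin 4) (Fin 4) ℚ_[p] :=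
  !![0,0,1,0; 0,0,0,1; -1,0,0,0; 0,-1,0,0]

/-- `GSp₄(ℚ_p)`. -/
def GSp4 : Set (Matrix (Fin 4) (Fin 4) ℚ_[p]) :=
  {g | IsUnit g.det ∧ ∃ μ : ℚ_[p]ˣ, gᵀ * Jmat p * g = (μ : ℚ_[p]) • Jmat p}

/-- `K_p = GSp₄(ℤ_p)`, viewed inside `GSp₄(ℚ_p)`. -/
def Kp : Set (Matrix (Fin 4) (Fin 4) ℚ_[p]) :=
  {g | g ∈ GSp4 p ∧ (∀ i j, ‖g i j‖ ≤ 1) ∧ ‖g.det‖ = 1}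

/-- The Iwahori subgroup `I_p`: elements of `K_p` whose reduction mod `p` has zero
entries at positions (1,2), (3,1), (3,2), (4,1), (4,2), (4,3) (0-indexed below). -/
def Ip : Set (Matrix (Fin 4) (Fin 4) ℚ_[p]) :=
  {g | g ∈ Kp p ∧ ‖g 0 1‖ < 1 ∧ ‖g 2 0‖ < 1 ∧ ‖g 2 1‖ < 1 ∧
      ‖g 3 0‖ < 1 ∧ ‖g 3 1‖ < 1 ∧ ‖g 3 2‖ < 1}

/-- The matrix `U_x` for `x = (n,q,r)`. -/
def Umat (n q r : ℚ_[p]) : Matrix (Fin 4) (Fin 4) ℚ_[p] :=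
  !![1,0,n,q; 0,1,q,r; 0,0,1,0; 0,0,0,1]

/-- The matrix `Z_y` for `y ∈ ℤ_p`. -/
def Zmat (y : ℚ_[p]) : Matrix (Fin 4) (Fin 4) ℚ_[p] :=
  !![1,y,0,0; 0,1,0,0; 0,0,1,0; 0,0,-y,1]

/-- The matrix `Z_∞`. -/
def Zinf : Matrix (Fin 4) (Fin 4) ℚ_[p] :=
  !![0,1,0,0; 1,0,0,0; 0,0,0,1; 0,0,1,0]

/-- Assemble a 4×4 matrix from 2×2 blocks. -/
def blk (A B C D : Matrix (Fin 2) (Fin 2) ℚ_[p]) : Matrix (Fin 4) (Fin 4) ℚ_[p] :=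
  Matrix.reindex finSumFinEquiv finSumFinEquiv (fromBlocks A B C D)

variable (a b c : ℚ_[p])

/-- The matrix `S = (a, b/2; b/2, c)`. -/
def Smat : Matrix (Fin 2) (Fin 2) ℚ_[p] := !![a, b/2; b/2, c]

/-- The matrix `ξ = (b/2, c; −a, −b/2)`. -/
def xiS : Matrix (Fin 2) (Fin 2) ℚ_[p] := !![b/2, c; -a, -b/2]

/-- The torus `T(ℚ_p) = {g ∈ GL₂(ℚ_p) : gᵀSg = det(g)·S}`. -/
def Tgrp : Set (Matrix (Fin 2) (Fin 2) ℚ_[p]) :=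
  {g | IsUnit g.det ∧ gᵀ * Smat p a b c * g = g.det • Smat p a b c}

/-- The embedding `g ↦ diag(g, det(g)·(g⁻¹)ᵀ)` of `GL₂` into `GSp₄`. -/
def emb (g : Matrix (Fin 2) (Fin 2) ℚ_[p]) : Matrix (Fin 4) (Fin 4) ℚ_[p] :=
  blk p g 0 0 (g.det • (g⁻¹)ᵀ)

/-- The unipotent group `U(ℚ_p)`. -/
def Ugrp : Set (Matrix (Fin 4) (Fin 4) ℚ_[p]) :=
  {u | ∃ X : Matrix (Fin 2) (Fin 2) ℚ_[p], Xᵀ = X ∧ u = blk p 1 X 0 1}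

/-- The Bessel group `R(ℚ_p) = T(ℚ_p)·U(ℚ_p)` inside `GSp₄(ℚ_p)`. -/
def Rgrp : Set (Matrix (Fin 4) (Fin 4) ℚ_[p]) :=
  {r | ∃ t ∈ Tgrp p a b c, ∃ u ∈ Ugrp p, r = emb p t * u}

/-- `h(l,m) = diag(p^{2m+l}, p^{m+l}, 1, p^m)`. -/
def hmat (l : ℤ) (m : ℕ) : Matrix (Fin 4) (Fin 4) ℚ_[p] :=
  diagonal ![(p : ℚ_[p]) ^ (2 * (m : ℤ) + l), (p : ℚ_[p]) ^ ((m : ℤ) + l), 1, (p : ℚ_[p]) ^ (m : ℤ)]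

/-- `(l,m)`-equivalence: `f ~ g` iff `r·h(l,m)·f·k = h(l,m)·g` for some
`r ∈ R(ℚ_p)`, `k ∈ I_p`. -/
def LMEquiv (l : ℤ) (m : ℕ) (f g : Matrix (Fin 4) (Fin 4) ℚ_[p]) : Prop :=
  ∃ r ∈ Rgrp p a b c, ∃ k ∈ Ip p, r * hmat p l m * f * k = hmat p l m * g

/-- `t₁ = B_{(1,0,0)}^0`. -/
def t1 : Matrix (Fin 4) (Fin 4) ℚ_[p] := Jmat p * Umat p 1 0 0 * Jmat p * Zmat p 0
/-- `t₂ = B_{(1,0,0)}^∞`. -/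
def t2 : Matrix (Fin 4) (Fin 4) ℚ_[p] := Jmat p * Umat p 1 0 0 * Jmat p * Zinf p
/-- `t₃ = B_{(0,0,1)}^0`. -/
def t3 : Matrix (Fin 4) (Fin 4) ℚ_[p] := Jmat p * Umat p 0 0 1 * Jmat p * Zmat p 0
/-- `t₄ = B_{(0,0,1)}^∞`. -/
def t4 : Matrix (Fin 4) (Fin 4) ℚ_[p] := Jmat p * Umat p 0 0 1 * Jmat p * Zinf p
/-- `t₅ = B_{(0,0,0)}^0`. -/
def t5 : Matrix (Fin 4) (Fin 4) ℚ_[p] := Jmat p * Umat p 0 0 0 * Jmat p * Zmat p 0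
/-- `t₆ = B_{(0,0,0)}^∞`. -/
def t6 : Matrix (Fin 4) (Fin 4) ℚ_[p] := Jmat p * Umat p 0 0 0 * Jmat p * Zinf p
/-- `t₇ = A_{(0,0,0)}^0`. -/
def t7 : Matrix (Fin 4) (Fin 4) ℚ_[p] := Umat p 0 0 0 * Jmat p * Zmat p 0
/-- `t₈ = A_{(0,0,0)}^∞`. -/
def t8 : Matrix (Fin 4) (Fin 4) ℚ_[p] := Umat p 0 0 0 * Jmat p * Zinf p

/-- `T_m`: `{t₁,…,t₈}` if `m > 0`, and `{t₁, t₂, t₅, t₇}` if `m = 0`. -/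
def TsetM (m : ℕ) : Set (Matrix (Fin 4) (Fin 4) ℚ_[p]) :=
  if m = 0 then {t1 p, t2 p, t5 p, t7 p}
  else {t1 p, t2 p, t3 p, t4 p, t5 p, t6 p, t7 p, t8 p}

/-- `GL₂(ℤ_p)` viewed inside `GL₂(ℚ_p)`: integral entries and unit determinant. -/
def GL2Z : Set (Matrix (Fin 2) (Fin 2) ℚ_[p]) :=
  {g | (∀ i j, ‖g i j‖ ≤ 1) ∧ ‖g.det‖ = 1}

/-- `Γ⁰_p`: elements of `GL₂(ℤ_p)` that are lower triangular mod `p`. -/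
def Gamma0upper : Set (Matrix (Fin 2) (Fin 2) ℚ_[p]) :=
  {g | g ∈ GL2Z p ∧ ‖g 0 1‖ < 1}

/-- `Γ_{0,p}`: elements of `GL₂(ℤ_p)` that are upper triangular mod `p`. -/
def Gamma0lower : Set (Matrix (Fin 2) (Fin 2) ℚ_[p]) :=
  {g | g ∈ GL2Z p ∧ ‖g 1 0‖ < 1}

/-- `U(ℤ_p)`: unipotent matrices `(1, X; 0, 1)` with `X` symmetric integral. -/
def UZ : Set (Matrix (Fin 4) (Fin 4) ℚ_[p]) :=
  {u | ∃ X : Matrix (Fin 2) (Fin 2) ℚ_[p], Xᵀ = X ∧ (∀ i j, ‖X i j‖ ≤ 1) ∧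
    u = blk p 1 X 0 1}

/-- The product set `U(ℤ_p)·GL₂(ℤ_p)` inside `GSp₄(ℚ_p)`. -/
def UGL : Set (Matrix (Fin 4) (Fin 4) ℚ_[p]) :=
  {m | ∃ u ∈ UZ p, ∃ g ∈ GL2Z p, m = u * emb p g}

/-- `G_t = t⁻¹·U(ℤ_p)GL₂(ℤ_p)·t ∩ I_p`. -/
def Gt (t : Matrix (Fin 4) (Fin 4) ℚ_[p]) : Set (Matrix (Fin 4) (Fin 4) ℚ_[p]) :=
  {x | (∃ m ∈ UGL p, x = t⁻¹ * m * t) ∧ x ∈ Ip p}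

/-- `G_t¹ = t·G_t·t⁻¹`. -/
def Gt1 (t : Matrix (Fin 4) (Fin 4) ℚ_[p]) : Set (Matrix (Fin 4) (Fin 4) ℚ_[p]) :=
  {x | ∃ y ∈ Gt p t, x = t * y * t⁻¹}

/-- `H_t = {x ∈ GL₂(ℤ_p) : y·x ∈ G_t¹ for some y ∈ U(ℤ_p)}`. -/
def Ht (t : Matrix (Fin 4) (Fin 4) ℚ_[p]) : Set (Matrix (Fin 2) (Fin 2) ℚ_[p]) :=
  {x | x ∈ GL2Z p ∧ ∃ y ∈ UZ p, y * emb p x ∈ Gt1 p t}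

/-- The index `[U(ℤ_p)·GL₂(ℤ_p) : G_t¹]`, i.e. the number of left cosets
`m·G_t¹` with `m ∈ U(ℤ_p)·GL₂(ℤ_p)`. -/
def indexGt1 (t : Matrix (Fin 4) (Fin 4) ℚ_[p]) : ℕ :=
  {C : Set (Matrix (Fin 4) (Fin 4) ℚ_[p]) |
    ∃ m ∈ UGL p, C = (fun x => m * x) '' Gt1 p t}.ncard

/-! ### Left cosets of a subgroup seen through an embedding into a monoid -/

/-- The left translates of the image of `K ≤ P` under an injective homomorphism, by elements of the
image of `P`, are counted by the relative index of `K` in `P`. -/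
lemma ncard_translates_eq_relIndex {G M : Type*} [Group G] [Monoid M] (ι : G →* M)
    (hι : Function.Injective ι) {K P : Subgroup G} (hKP : K ≤ P) :
    {C : Set M | ∃ m ∈ ι '' P, C = (fun x => m * x) '' (ι '' K)}.ncard = K.relIndex P := by
  let f : P ⧸ K.subgroupOf P → Set M := fun q => {x | ∃ g : P, (g : P ⧸ K.subgroupOf P) = q ∧ ι g = x}
  have hf : Function.Injective f := by
    intro q r h
    obtain ⟨g, rfl⟩ := QuotientGroup.mk_surjective q
    have hg : ι g ∈ f (g : P ⧸ K.subgroupOf P) := ⟨g, rfl, rfl⟩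
    rw [h] at hg
    obtain ⟨k, hk, hkg⟩ := hg
    rw [← hk, Subtype.ext (hι hkg)]
  have hmk (g : P) : f g = (fun x => ι g * x) '' (ι '' K) := by
    ext x
    simp only [f, Set.mem_ofPred_eq, Set.mem_image, exists_exists_and_eq_and]
    constructor
    · rintro ⟨k, hk, rfl⟩
      refine ⟨(g : G)⁻¹ * k, ?_, by simp [← map_mul]⟩
      simpa [Subgroup.mem_subgroupOf] using QuotientGroup.eq.mp hk.symm
    · rintro ⟨k, hk, rfl⟩
      refine ⟨g * ⟨k, hKP hk⟩, QuotientGroup.mk_mul_of_mem _ ?_, by simp⟩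
      simpa [Subgroup.mem_subgroupOf] using hk
  have hrange : {C : Set M | ∃ m ∈ ι '' P, C = (fun x => m * x) '' (ι '' K)} = Set.range f := by
    ext C
    constructor
    · rintro ⟨_, ⟨g, hg, rfl⟩, rfl⟩
      exact ⟨((⟨g, hg⟩ : P) : P ⧸ K.subgroupOf P), hmk ⟨g, hg⟩⟩
    · rintro ⟨q, rfl⟩
      obtain ⟨g, rfl⟩ := QuotientGroup.mk_surjective q
      exact ⟨ι g, ⟨g, g.2, rfl⟩, hmk g⟩
  rw [hrange, Set.ncard_range_of_injective hf]
  rfl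

/-! ### The Siegel-type subgroup over a commutative ring -/

section CommRing

variable {R S : Type*} [CommRing R] [CommRing S]

/-- The matrix `(1, X; 0, 1) · diag(g, det(g)·(g⁻¹)ᵀ)` with `X = (v₀, v₁; v₁, v₂)` and
`g = (v₃, v₄; v₅, v₆)`. -/
def siegelMat (v : Fin 7 → R) : Matrix (Fin 4) (Fin 4) R :=
  !![v 3, v 4, v 0 * v 6 - v 1 * v 4, v 1 * v 3 - v 0 * v 5;
     v 5, v 6, v 1 * v 6 - v 2 * v 4, v 2 * v 3 - v 1 * v 5;
     0, 0, v 6, -v 5;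
     0, 0, -v 4, v 3]

/-- The determinant of the `GL₂`-part of `siegelMat v`. -/
def leviDet (v : Fin 7 → R) : R := v 3 * v 6 - v 4 * v 5

lemma siegelMat_map (f : R →+* S) (v : Fin 7 → R) :
    (siegelMat v).map f = siegelMat (f ∘ v) := by
  ext i j
  fin_cases i <;> fin_cases j <;> simp [siegelMat]

lemma leviDet_map (f : R →+* S) (v : Fin 7 → R) : leviDet (f ∘ v) = f (leviDet v) := by
  simp [leviDet]

lemma det_siegelMat (v : Fin 7 → R) : (siegelMat v).det = leviDet v ^ 2 := by
  simp [siegelMat, leviDet, Matrix.det_succ_row_zero, Fin.sum_univ_succ, Fin.succAbove]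
  ring

lemma siegelMat_injOn {v w : Fin 7 → R} (hv : IsUnit (leviDet v))
    (h : siegelMat v = siegelMat w) : v = w := by
  obtain ⟨u, hu⟩ := hv.exists_left_inv
  have e (i j) := congrFun₂ h i j
  have h3 := e 0 0
  have h4 := e 0 1
  have h5 := e 1 0
  have h6 := e 1 1
  have e0 := e 0 2
  have e1 := e 0 3
  have e2 := e 1 2
  have e3 := e 1 3
  simp [siegelMat] at h3 h4 h5 h6 e0 e1 e2 e3
  simp only [leviDet] at hu
  funext i
  fin_cases i
  · grind
  · grind
  · grind
  all_goals assumption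

/-- The parameters of the inverse of `siegelMat v`, where `u` is the inverse of `leviDet v`. -/
def siegelInv (u : R) (v : Fin 7 → R) : Fin 7 → R :=
  ![-u * (v 6 ^ 2 * v 0 - 2 * v 4 * v 6 * v 1 + v 4 ^ 2 * v 2),
    -u * (-v 5 * v 6 * v 0 + (v 3 * v 6 + v 4 * v 5) * v 1 - v 3 * v 4 * v 2),
    -u * (v 5 ^ 2 * v 0 - 2 * v 3 * v 5 * v 1 + v 3 ^ 2 * v 2),
    u * v 6, -u * v 4, -u * v 5, u * v 3]

/-- The parameters of the product of `siegelMat v` and `siegelMat w`, where `u` is the inverse of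
`leviDet v`. -/
def siegelMul (u : R) (v w : Fin 7 → R) : Fin 7 → R :=
  ![v 0 + u * (v 3 ^ 2 * w 0 + 2 * v 3 * v 4 * w 1 + v 4 ^ 2 * w 2),
    v 1 + u * (v 3 * v 5 * w 0 + (v 3 * v 6 + v 4 * v 5) * w 1 + v 4 * v 6 * w 2),
    v 2 + u * (v 5 ^ 2 * w 0 + 2 * v 5 * v 6 * w 1 + v 6 ^ 2 * w 2),
    v 3 * w 3 + v 4 * w 5, v 3 * w 4 + v 4 * w 6, v 5 * w 3 + v 6 * w 5, v 5 * w 4 + v 6 * w 6]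

lemma siegelMat_mul {u : R} {v : Fin 7 → R} (hu : u * leviDet v = 1) (w : Fin 7 → R) :
    siegelMat v * siegelMat w = siegelMat (siegelMul u v w) := by
  simp only [leviDet] at hu
  ext i j
  fin_cases i <;> fin_cases j <;>
    simp [siegelMat, siegelMul, Matrix.mul_apply, Fin.sum_univ_succ] <;> grind

lemma siegelMat_mul_inv {u : R} {v : Fin 7 → R} (hu : u * leviDet v = 1) :
    siegelMat v * siegelMat (siegelInv u v) = 1 := by
  simp only [leviDet] at hu
  ext i j
  fin_cases i <;> fin_cases j <;>
    simp [siegelMat, siegelInv, Matrix.mul_apply, Fin.sum_univ_succ] <;> grind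

lemma isUnit_leviDet {g : GL (Fin 4) R} {v : Fin 7 → R} (h : g.val = siegelMat v) :
    IsUnit (leviDet v) := by
  have := (Matrix.isUnit_iff_isUnit_det _).mp g.isUnit
  rw [h, det_siegelMat] at this
  exact (isUnit_pow_iff two_ne_zero).mp this

variable (R) in
/-- The group `U(R)·GL₂(R)` inside `GL₄(R)`. -/
def siegelGroup : Subgroup (GL (Fin 4) R) where
  carrier := {g | ∃ v, g.val = siegelMat v}
  one_mem' := by
    refine ⟨![0, 0, 0, 1, 0, 0, 1], ?_⟩
    ext i j
    fin_cases i <;> fin_cases j <;> simp [siegelMat]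
  mul_mem' := by
    rintro g h ⟨v, hv⟩ ⟨w, hw⟩
    obtain ⟨u, hu⟩ := (isUnit_leviDet hv).exists_left_inv
    exact ⟨_, by rw [Units.val_mul, hv, hw, siegelMat_mul hu]⟩
  inv_mem' := by
    rintro g ⟨v, hv⟩
    obtain ⟨u, hu⟩ := (isUnit_leviDet hv).exists_left_inv
    exact ⟨_, Units.inv_eq_of_mul_eq_one_right (by rw [hv, siegelMat_mul_inv hu])⟩

lemma exists_val_eq_siegelMat {v : Fin 7 → R} (hv : IsUnit (leviDet v)) :
    ∃ g : GL (Fin 4) R, g.val = siegelMat v := by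
  have : IsUnit (siegelMat v) := by
    rw [Matrix.isUnit_iff_isUnit_det, det_siegelMat]
    exact hv.pow 2
  exact this

variable (R) in
/-- The matrix `J` over a commutative ring. -/
def sympMat : Matrix (Fin 4) (Fin 4) R :=
  !![0, 0, 1, 0; 0, 0, 0, 1; -1, 0, 0, 0; 0, -1, 0, 0]

variable (R) in
/-- The group of symplectic similitudes `GSp₄(R)`, as a subgroup of `GL₄(R)`. -/
def similitudeGroup : Subgroup (GL (Fin 4) R) where
  carrier := {g | ∃ μ : Rˣ, g.valᵀ * sympMat R * g.val = (μ : R) • sympMat R}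
  one_mem' := ⟨1, by simp⟩
  mul_mem' := by
    rintro g h ⟨μ, hμ⟩ ⟨ν, hν⟩
    refine ⟨μ * ν, ?_⟩
    calc (g * h).valᵀ * sympMat R * (g * h).val
        = h.valᵀ * (g.valᵀ * sympMat R * g.val) * h.val := by
          simp [Matrix.transpose_mul, Matrix.mul_assoc]
      _ = _ := by rw [hμ]; simp [hν, smul_smul]
  inv_mem' := by
    rintro g ⟨μ, hμ⟩
    refine ⟨μ⁻¹, ?_⟩
    have h1 : g.val * (g⁻¹).val = 1 := g.mul_inv
    have h2 : (g⁻¹).valᵀ * g.valᵀ = 1 := by rw [← Matrix.transpose_mul, h1, Matrix.transpose_one]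
    have h3 : (g⁻¹).valᵀ * (g.valᵀ * sympMat R * g.val) * (g⁻¹).val = sympMat R := by
      rw [show (g⁻¹).valᵀ * (g.valᵀ * sympMat R * g.val) * (g⁻¹).val
        = ((g⁻¹).valᵀ * g.valᵀ) * sympMat R * (g.val * (g⁻¹).val) by
          simp only [Matrix.mul_assoc], h1, h2, one_mul, mul_one]
    rw [hμ] at h3
    conv_rhs => rw [← h3]
    simp [smul_smul]

lemma siegelGroup_le_similitudeGroup : siegelGroup R ≤ similitudeGroup R := by
  rintro g ⟨v, hv⟩
  obtain ⟨μ, hμ⟩ := isUnit_leviDet hv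
  refine ⟨μ, ?_⟩
  rw [hμ, hv]
  ext i j
  fin_cases i <;> fin_cases j <;>
    simp [siegelMat, sympMat, leviDet, Matrix.mul_apply, Fin.sum_univ_succ] <;> ring

/-! ### The coset representatives over a commutative ring -/

variable (R) in
/-- The matrix `J` as an invertible matrix. -/
def sympUnit : GL (Fin 4) R where
  val := sympMat R
  inv := -sympMat R
  val_inv := by
    ext i j
    fin_cases i <;> fin_cases j <;> simp [sympMat, Matrix.mul_apply, Fin.sum_univ_succ]
  inv_val := by
    ext i j
    fin_cases i <;> fin_cases j <;> simp [sympMat, Matrix.mul_apply, Fin.sum_univ_succ]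

variable (R) in
/-- The matrix `Z_∞` as an invertible matrix. -/
def swapUnit : GL (Fin 4) R where
  val := !![0, 1, 0, 0; 1, 0, 0, 0; 0, 0, 0, 1; 0, 0, 1, 0]
  inv := !![0, 1, 0, 0; 1, 0, 0, 0; 0, 0, 0, 1; 0, 0, 1, 0]
  val_inv := by
    ext i j
    fin_cases i <;> fin_cases j <;> simp [Matrix.mul_apply, Fin.sum_univ_succ]
  inv_val := by
    ext i j
    fin_cases i <;> fin_cases j <;> simp [Matrix.mul_apply, Fin.sum_univ_succ]

/-- The matrix `J·U_{(n,0,r)}·J` as an invertible matrix. -/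
def lowerUnit (n r : R) : GL (Fin 4) R where
  val := !![-1, 0, 0, 0; 0, -1, 0, 0; n, 0, -1, 0; 0, r, 0, -1]
  inv := !![-1, 0, 0, 0; 0, -1, 0, 0; -n, 0, -1, 0; 0, -r, 0, -1]
  val_inv := by
    ext i j
    fin_cases i <;> fin_cases j <;> simp [Matrix.mul_apply, Fin.sum_univ_succ]
  inv_val := by
    ext i j
    fin_cases i <;> fin_cases j <;> simp [Matrix.mul_apply, Fin.sum_univ_succ]

lemma sympUnit_mem : sympUnit R ∈ similitudeGroup R := by
  refine ⟨1, ?_⟩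
  ext i j
  fin_cases i <;> fin_cases j <;>
    simp [sympUnit, sympMat, Matrix.mul_apply, Fin.sum_univ_succ]

lemma swapUnit_mem : swapUnit R ∈ similitudeGroup R := by
  refine ⟨1, ?_⟩
  ext i j
  fin_cases i <;> fin_cases j <;>
    simp [swapUnit, sympMat, Matrix.mul_apply, Fin.sum_univ_succ]

lemma lowerUnit_mem (n r : R) : lowerUnit n r ∈ similitudeGroup R := by
  refine ⟨1, ?_⟩
  ext i j
  fin_cases i <;> fin_cases j <;>
    simp [lowerUnit, sympMat, Matrix.mul_apply, Fin.sum_univ_succ]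

lemma map_sympUnit (f : R →+* S) : GeneralLinearGroup.map f (sympUnit R) = sympUnit S := by
  ext i j
  fin_cases i <;> fin_cases j <;> simp [sympUnit, sympMat]

lemma map_swapUnit (f : R →+* S) : GeneralLinearGroup.map f (swapUnit R) = swapUnit S := by
  ext i j
  fin_cases i <;> fin_cases j <;> simp [swapUnit]

lemma map_lowerUnit (f : R →+* S) (n r : R) :
    GeneralLinearGroup.map f (lowerUnit n r) = lowerUnit (f n) (f r) := by
  ext i j
  fin_cases i <;> fin_cases j <;> simp [lowerUnit]

end CommRing

/-! ### Counting over a finite field -/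

section Field

variable {F : Type*} [Field F]

/-- The vanishing pattern defining the Iwahori subgroup. -/
def IwahoriPattern {R : Type*} [Zero R] (g : Matrix (Fin 4) (Fin 4) R) : Prop :=
  g 0 1 = 0 ∧ g 2 0 = 0 ∧ g 2 1 = 0 ∧ g 3 0 = 0 ∧ g 3 1 = 0 ∧ g 3 2 = 0

lemma iwahoriPattern_iff_blockTriangular {R : Type*} [Zero R] (g : Matrix (Fin 4) (Fin 4) R) :
    IwahoriPattern g ↔ g.BlockTriangular (![1, 0, 2, 3] : Fin 4 → ℕ) := by
  constructor
  · rintro ⟨h1, h2, h3, h4, h5, h6⟩ i j hij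
    fin_cases i <;> fin_cases j <;> simp_all
  · intro h
    exact ⟨h (by decide), h (by decide), h (by decide), h (by decide), h (by decide),
      h (by decide)⟩

variable (F) in
/-- The Borel subgroup of `GL₄(F)` onto which the Iwahori subgroup reduces. -/
def borelGroup : Subgroup (GL (Fin 4) F) where
  carrier := {g | IwahoriPattern g.val}
  one_mem' := (iwahoriPattern_iff_blockTriangular _).mpr blockTriangular_one
  mul_mem' := by
    intro g h hg hh
    simp only [Set.mem_ofPred_eq, iwahoriPattern_iff_blockTriangular] at hg hh ⊢
    exact hg.mul hh
  inv_mem' := by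
    intro g hg
    simp only [Set.mem_ofPred_eq, iwahoriPattern_iff_blockTriangular] at hg ⊢
    have : Invertible g.val := g.invertible
    rw [GeneralLinearGroup.coe_inv]
    exact blockTriangular_inv_of_blockTriangular hg

/-- The subgroup `τ·B·τ⁻¹`. -/
def conjBorel (τ : GL (Fin 4) F) : Subgroup (GL (Fin 4) F) :=
  (borelGroup F).comap (MulAut.conj τ⁻¹).toMonoidHom

lemma mem_conjBorel {τ g : GL (Fin 4) F} :
    g ∈ conjBorel τ ↔ IwahoriPattern (τ⁻¹.val * g.val * τ.val) := by
  change IwahoriPattern (τ⁻¹ * g * τ⁻¹⁻¹).val ↔ _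
  simp

lemma card_inf_siegelGroup {α : Type*} (H : Subgroup (GL (Fin 4) F)) (v : α → Fin 7 → F)
    (hinj : Function.Injective v) (hdet : ∀ s, leviDet (v s) ≠ 0)
    (hH : ∀ (g : GL (Fin 4) F) (w : Fin 7 → F), g.val = siegelMat w → leviDet w ≠ 0 →
      (g ∈ H ↔ ∃ s, v s = w)) :
    Nat.card (H ⊓ siegelGroup F : Subgroup (GL (Fin 4) F)) = Nat.card α := by
  choose γ hγ using fun s => exists_val_eq_siegelMat (hdet s).isUnit
  have hmem (s) : γ s ∈ H ⊓ siegelGroup F :=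
    ⟨(hH _ _ (hγ s) (hdet s)).mpr ⟨s, rfl⟩, ⟨_, hγ s⟩⟩
  refine (Nat.card_congr (Equiv.ofBijective (fun s => ⟨γ s, hmem s⟩) ⟨?_, ?_⟩)).symm
  · intro s t h
    have h' : γ s = γ t := congrArg Subtype.val h
    apply hinj
    apply siegelMat_injOn (hdet s).isUnit
    rw [← hγ, ← hγ, h']
  · rintro ⟨g, hg, w, hw⟩
    obtain ⟨s, hs⟩ := (hH g w hw (isUnit_leviDet hw).ne_zero).mp hg
    refine ⟨s, Subtype.ext (Units.ext ?_)⟩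
    rw [hγ, hw, hs]

lemma card_siegelGroup [Fintype F] :
    Nat.card (siegelGroup F) = Fintype.card F ^ 3 *
      ((Fintype.card F ^ 2 - 1) * (Fintype.card F ^ 2 - Fintype.card F)) := by
  have h := card_inf_siegelGroup (α := F × F × F × GL (Fin 2) F) ⊤
    (fun s => ![s.1, s.2.1, s.2.2.1, s.2.2.2 0 0, s.2.2.2 0 1, s.2.2.2 1 0, s.2.2.2 1 1])
    ?_ ?_ ?_
  · rw [top_inf_eq] at h
    rw [h]
    simp only [Nat.card_prod, Matrix.card_GL_field, Fin.prod_univ_two, Nat.card_eq_fintype_card]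
    simp only [Fin.val_zero, Fin.val_one, pow_zero, pow_one]
    ring
  · rintro ⟨x, y, z, g⟩ ⟨x', y', z', g'⟩ h
    have e := congrFun h
    have e0 := e 0
    have e1 := e 1
    have e2 := e 2
    have e3 := e 3
    have e4 := e 4
    have e5 := e 5
    have e6 := e 6
    simp at e0 e1 e2 e3 e4 e5 e6
    have : g = g' := by
      ext i j
      fin_cases i <;> fin_cases j <;> assumption
    simp [e0, e1, e2, this]
  · rintro ⟨x, y, z, g⟩
    have := ((Matrix.isUnit_iff_isUnit_det _).mp g.isUnit).ne_zero
    rw [Matrix.det_fin_two] at this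
    exact this
  · intro g w _ hw
    have : IsUnit !![w 3, w 4; w 5, w 6] := by
      rw [Matrix.isUnit_iff_isUnit_det, Matrix.det_fin_two]
      exact hw.isUnit
    obtain ⟨γ, hγ⟩ := this
    refine ⟨fun _ => ⟨(w 0, w 1, w 2, γ), ?_⟩, fun _ => trivial⟩
    funext i
    fin_cases i <;> simp [hγ]

lemma relIndex_siegelGroup [Fintype F] {j k : ℕ} (hjk : k + j = 4) (H : Subgroup (GL (Fin 4) F))
    (v : (Fin k → F) × Fˣ × Fˣ → Fin 7 → F)
    (hinj : Function.Injective v) (hdet : ∀ s, leviDet (v s) ≠ 0)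
    (hH : ∀ (g : GL (Fin 4) F) (w : Fin 7 → F), g.val = siegelMat w → leviDet w ≠ 0 →
      (g ∈ H ↔ ∃ s, v s = w)) :
    H.relIndex (siegelGroup F) = Fintype.card F ^ j * (Fintype.card F + 1) := by
  have h1 := card_inf_siegelGroup H v hinj hdet hH
  have h2 := card_siegelGroup (F := F)
  have h3 := Subgroup.relIndex_mul_relIndex ⊥ (H ⊓ siegelGroup F) (siegelGroup F) bot_le inf_le_right
  rw [Subgroup.relIndex_bot_left, Subgroup.relIndex_bot_left, Subgroup.inf_relIndex_right, h1, h2]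
    at h3
  have hu : Nat.card Fˣ = Fintype.card F - 1 := by
    rw [Nat.card_units, Nat.card_eq_fintype_card]
  have hk : Nat.card (Fin k → F) = Fintype.card F ^ k := by simp
  have hq : 1 < Fintype.card F := Fintype.one_lt_card
  simp only [Nat.card_prod, hu, hk] at h3
  obtain ⟨n, hn⟩ : ∃ n, Fintype.card F = n + 1 := ⟨_, (Nat.succ_pred_eq_of_pos (by omega)).symm⟩
  rw [hn] at h3 hq ⊢
  have hn0 : 0 < n := by omega
  have e1 : (n + 1) ^ 2 - 1 = n * (n + 2) := by
    rw [Nat.sub_eq_iff_eq_add (Nat.one_le_pow _ _ (by omega))]; ring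
  have e2 : (n + 1) ^ 2 - (n + 1) = n * (n + 1) := by
    rw [Nat.sub_eq_iff_eq_add (by nlinarith)]; ring
  rw [e1, e2, Nat.add_sub_cancel] at h3
  have hpos : 0 < (n + 1) ^ k * (n * n) := by positivity
  apply Nat.eq_of_mul_eq_mul_left hpos
  rw [h3]
  have e4 : (n + 1) ^ 4 = (n + 1) ^ k * (n + 1) ^ j := by rw [← pow_add, hjk]
  linear_combination (n * n * (n + 2)) * e4

@[simp] lemma val_inv_lowerUnit (n r : F) : ((lowerUnit n r)⁻¹).val =
    !![-1, 0, 0, 0; 0, -1, 0, 0; -n, 0, -1, 0; 0, -r, 0, -1] := rfl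

@[simp] lemma val_inv_sympUnit : ((sympUnit F)⁻¹).val = -sympMat F := rfl

@[simp] lemma val_inv_swapUnit : ((swapUnit F)⁻¹).val =
    !![0, 1, 0, 0; 1, 0, 0, 0; 0, 0, 0, 1; 0, 0, 1, 0] := rfl

/-- A form of `relIndex_siegelGroup` in which the parametrization of the subgroup is checked through
its diagonal entries and free parameters. -/
lemma relIndex_conjBorel [Fintype F] {j k : ℕ} (hjk : k + j = 4) (τ : GL (Fin 4) F)
    (v : (Fin k → F) × Fˣ × Fˣ → Fin 7 → F) (c : (Fin 7 → F) → Fin k → F)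
    (hc : ∀ s, c (v s) = s.1) (h3 : ∀ s, v s 3 = s.2.1) (h6 : ∀ s, v s 6 = s.2.2)
    (h45 : ∀ s, v s 4 * v s 5 = 0)
    (hH : ∀ w, leviDet w ≠ 0 → (IwahoriPattern (τ⁻¹.val * siegelMat w * τ.val) ↔
      ∃ (h3 : w 3 ≠ 0) (h6 : w 6 ≠ 0), v (c w, Units.mk0 _ h3, Units.mk0 _ h6) = w)) :
    (conjBorel τ).relIndex (siegelGroup F) = Fintype.card F ^ j * (Fintype.card F + 1) := by
  refine relIndex_siegelGroup hjk _ v ?_ ?_ ?_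
  · intro s t h
    refine Prod.ext ?_ (Prod.ext (Units.ext ?_) (Units.ext ?_))
    · rw [← hc, ← hc, h]
    · rw [← h3, ← h3, h]
    · rw [← h6, ← h6, h]
  · intro s
    simp [leviDet, h3, h6, h45]
  · intro g w hg hw
    rw [mem_conjBorel, hg, hH w hw]
    constructor
    · rintro ⟨_, _, h⟩
      exact ⟨_, h⟩
    · rintro ⟨s, rfl⟩
      refine ⟨by simp [h3], by simp [h6], ?_⟩
      congr 1
      refine Prod.ext (hc s) (Prod.ext (Units.ext ?_) (Units.ext ?_))
      · simp [h3]
      · simp [h6]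

lemma relIndex_lower_one_zero [Fintype F] :
    (conjBorel (lowerUnit 1 0 : GL (Fin 4) F)).relIndex (siegelGroup F) =
      Fintype.card F ^ 1 * (Fintype.card F + 1) := by
  refine relIndex_conjBorel (k := 3) rfl _
    (fun s => ![s.2.1 / s.2.2 - 1, s.1 0, s.1 1, s.2.1, 0, s.1 2, s.2.2])
    (fun w => ![w 1, w 2, w 5]) ?_ (fun _ => rfl) (fun _ => rfl) (fun _ => by simp) ?_
  · intro s
    funext i
    fin_cases i <;> rfl
  · intro w hw
    simp [IwahoriPattern, lowerUnit, siegelMat, leviDet,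
      Matrix.mul_apply, Fin.sum_univ_succ, funext_iff, Fin.forall_fin_succ] at hw ⊢
    grind

lemma relIndex_lower_one_zero_swap [Fintype F] :
    (conjBorel (lowerUnit 1 0 * swapUnit F : GL (Fin 4) F)).relIndex (siegelGroup F) =
      Fintype.card F ^ 2 * (Fintype.card F + 1) := by
  refine relIndex_conjBorel (k := 2) rfl _
    (fun s => ![s.2.1 / s.2.2 - 1, s.1 1 / s.2.2, s.1 0, s.2.1, 0, s.1 1, s.2.2])
    (fun w => ![w 2, w 5]) ?_ (fun _ => rfl) (fun _ => rfl) (fun _ => by simp) ?_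
  · intro s
    funext i
    fin_cases i <;> rfl
  · intro w hw
    simp [IwahoriPattern, lowerUnit, swapUnit, siegelMat, leviDet,
      Matrix.mul_apply, Fin.sum_univ_succ, funext_iff, Fin.forall_fin_succ] at hw ⊢
    grind

lemma relIndex_lower_zero_one [Fintype F] :
    (conjBorel (lowerUnit 0 1 : GL (Fin 4) F)).relIndex (siegelGroup F) =
      Fintype.card F ^ 2 * (Fintype.card F + 1) := by
  refine relIndex_conjBorel (k := 2) rfl _
    (fun s => ![s.1 0, s.1 1, s.2.2 / s.2.1 - 1, s.2.1, s.1 1 * s.2.1, 0, s.2.2])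
    (fun w => ![w 0, w 1]) ?_ (fun _ => rfl) (fun _ => rfl) (fun _ => by simp) ?_
  · intro s
    funext i
    fin_cases i <;> rfl
  · intro w hw
    simp [IwahoriPattern, lowerUnit, siegelMat, leviDet,
      Matrix.mul_apply, Fin.sum_univ_succ, funext_iff, Fin.forall_fin_succ] at hw ⊢
    grind

lemma relIndex_lower_zero_one_swap [Fintype F] :
    (conjBorel (lowerUnit 0 1 * swapUnit F : GL (Fin 4) F)).relIndex (siegelGroup F) =
      Fintype.card F ^ 1 * (Fintype.card F + 1) := by
  refine relIndex_conjBorel (k := 3) rfl _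
    (fun s => ![s.1 0, s.1 1, s.2.2 / s.2.1 - 1, s.2.1, s.1 2, 0, s.2.2])
    (fun w => ![w 0, w 1, w 4]) ?_ (fun _ => rfl) (fun _ => rfl) (fun _ => by simp) ?_
  · intro s
    funext i
    fin_cases i <;> rfl
  · intro w hw
    simp [IwahoriPattern, lowerUnit, swapUnit, siegelMat, leviDet,
      Matrix.mul_apply, Fin.sum_univ_succ, funext_iff, Fin.forall_fin_succ] at hw ⊢
    grind

lemma relIndex_lower_zero_zero [Fintype F] :
    (conjBorel (lowerUnit 0 0 : GL (Fin 4) F)).relIndex (siegelGroup F) =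
      Fintype.card F ^ 0 * (Fintype.card F + 1) := by
  refine relIndex_conjBorel (k := 4) rfl _
    (fun s => ![s.1 0, s.1 1, s.1 2, s.2.1, 0, s.1 3, s.2.2])
    (fun w => ![w 0, w 1, w 2, w 5]) ?_ (fun _ => rfl) (fun _ => rfl) (fun _ => by simp) ?_
  · intro s
    funext i
    fin_cases i <;> rfl
  · intro w hw
    simp [IwahoriPattern, lowerUnit, siegelMat, leviDet,
      Matrix.mul_apply, Fin.sum_univ_succ, funext_iff, Fin.forall_fin_succ] at hw ⊢
    grind

lemma relIndex_lower_zero_zero_swap [Fintype F] :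
    (conjBorel (lowerUnit 0 0 * swapUnit F : GL (Fin 4) F)).relIndex (siegelGroup F) =
      Fintype.card F ^ 0 * (Fintype.card F + 1) := by
  refine relIndex_conjBorel (k := 4) rfl _
    (fun s => ![s.1 0, s.1 1, s.1 2, s.2.1, s.1 3, 0, s.2.2])
    (fun w => ![w 0, w 1, w 2, w 4]) ?_ (fun _ => rfl) (fun _ => rfl) (fun _ => by simp) ?_
  · intro s
    funext i
    fin_cases i <;> rfl
  · intro w hw
    simp [IwahoriPattern, lowerUnit, swapUnit, siegelMat, leviDet,
      Matrix.mul_apply, Fin.sum_univ_succ, funext_iff, Fin.forall_fin_succ] at hw ⊢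
    grind

lemma relIndex_symp [Fintype F] :
    (conjBorel (sympUnit F : GL (Fin 4) F)).relIndex (siegelGroup F) =
      Fintype.card F ^ 3 * (Fintype.card F + 1) := by
  refine relIndex_conjBorel (k := 1) rfl _
    (fun s => ![0, 0, 0, s.2.1, s.1 0, 0, s.2.2])
    (fun w => ![w 4]) ?_ (fun _ => rfl) (fun _ => rfl) (fun _ => by simp) ?_
  · intro s
    funext i
    fin_cases i
    rfl
  · intro w hw
    simp [IwahoriPattern, sympUnit, sympMat, siegelMat, leviDet,
      Matrix.mul_apply, Fin.sum_univ_succ, funext_iff, Fin.forall_fin_succ] at hw ⊢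
    grind

lemma relIndex_symp_swap [Fintype F] :
    (conjBorel (sympUnit F * swapUnit F : GL (Fin 4) F)).relIndex (siegelGroup F) =
      Fintype.card F ^ 3 * (Fintype.card F + 1) := by
  refine relIndex_conjBorel (k := 1) rfl _
    (fun s => ![0, 0, 0, s.2.1, 0, s.1 0, s.2.2])
    (fun w => ![w 5]) ?_ (fun _ => rfl) (fun _ => rfl) (fun _ => by simp) ?_
  · intro s
    funext i
    fin_cases i
    rfl
  · intro w hw
    simp [IwahoriPattern, swapUnit, sympUnit, sympMat, siegelMat, leviDet,
      Matrix.mul_apply, Fin.sum_univ_succ, funext_iff, Fin.forall_fin_succ] at hw ⊢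
    grind

end Field

/-! ### Passing from `ℚ_p` to `ℤ_p` and to `𝔽_p` -/

/-- The inclusion of `GL₄(ℤ_p)` in the 4×4 matrices over `ℚ_p`. -/
def padicIncl : GL (Fin 4) ℤ_[p] →* Matrix (Fin 4) (Fin 4) ℚ_[p] :=
  (RingHom.mapMatrix (PadicInt.Coe.ringHom (p := p))).toMonoidHom.comp (Units.coeHom _)

variable {p}

lemma padicIncl_eq_map (g : GL (Fin 4) ℤ_[p]) :
    padicIncl p g = g.val.map (PadicInt.Coe.ringHom (p := p)) := rfl

lemma padicIncl_apply (g : GL (Fin 4) ℤ_[p]) (i j : Fin 4) :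
    padicIncl p g i j = (g.val i j : ℚ_[p]) := rfl

lemma padicIncl_injective : Function.Injective (padicIncl p) := by
  intro g h hgh
  ext i j
  exact PadicInt.ext (congrFun₂ hgh i j)

lemma inv_padicIncl (g : GL (Fin 4) ℤ_[p]) : (padicIncl p g)⁻¹ = padicIncl p g⁻¹ :=
  Matrix.inv_eq_right_inv (by rw [← map_mul, mul_inv_cancel, map_one])

lemma toZMod_eq_zero_iff (x : ℤ_[p]) : PadicInt.toZMod x = 0 ↔ ‖(x : ℚ_[p])‖ < 1 := by
  rw [← RingHom.mem_ker, PadicInt.ker_toZMod, IsLocalRing.mem_maximalIdeal, PadicInt.mem_nonunits]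
  rfl

lemma isUnit_of_toZMod_ne_zero {x : ℤ_[p]} (h : PadicInt.toZMod x ≠ 0) : IsUnit x := by
  by_contra hx
  rw [PadicInt.not_isUnit_iff] at hx
  exact h ((toZMod_eq_zero_iff x).mpr hx)

lemma padicIncl_mem_Kp {g : GL (Fin 4) ℤ_[p]} (hg : g ∈ similitudeGroup ℤ_[p]) :
    padicIncl p g ∈ Kp p := by
  have hdet : (padicIncl p g).det = ((g.val.det : ℤ_[p]) : ℚ_[p]) :=
    ((PadicInt.Coe.ringHom (p := p)).map_det g.val).symm
  have hunit : IsUnit g.val.det := (Matrix.isUnit_iff_isUnit_det _).mp g.isUnit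
  have hJ : Jmat p = (sympMat ℤ_[p]).map (PadicInt.Coe.ringHom (p := p)) := by
    ext i j
    fin_cases i <;> fin_cases j <;> simp [Jmat, sympMat]
  refine ⟨⟨?_, ?_⟩, fun i j => ?_, ?_⟩
  · rw [hdet]
    exact hunit.map (PadicInt.Coe.ringHom (p := p))
  · obtain ⟨μ, hμ⟩ := hg
    refine ⟨Units.map (PadicInt.Coe.ringHom (p := p)).toMonoidHom μ, ?_⟩
    rw [hJ, padicIncl_eq_map, ← Matrix.transpose_map, ← Matrix.map_mul, ← Matrix.map_mul, hμ]
    ext i j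
    simp
  · rw [padicIncl_apply]
    exact PadicInt.norm_le_one _
  · rw [hdet]
    exact PadicInt.isUnit_iff.mp hunit

/-- Reduction modulo `p` on `GL₄(ℤ_p)`. -/
abbrev redGL : GL (Fin 4) ℤ_[p] →* GL (Fin 4) (ZMod p) :=
  GeneralLinearGroup.map (PadicInt.toZMod (p := p))

lemma padicIncl_mem_Ip_iff {g : GL (Fin 4) ℤ_[p]} (hg : g ∈ similitudeGroup ℤ_[p]) :
    padicIncl p g ∈ Ip p ↔ redGL g ∈ borelGroup (ZMod p) := by
  change _ ∧ _ ↔ IwahoriPattern _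
  simp only [padicIncl_mem_Kp hg, true_and, IwahoriPattern, padicIncl_apply, redGL,
    GeneralLinearGroup.map_apply, toZMod_eq_zero_iff]

lemma map_siegelGroup : (siegelGroup ℤ_[p]).map redGL = siegelGroup (ZMod p) := by
  ext g
  constructor
  · rintro ⟨h, ⟨v, hv⟩, rfl⟩
    refine ⟨PadicInt.toZMod ∘ v, ?_⟩
    rw [← siegelMat_map, ← hv]
    rfl
  · rintro ⟨w, hw⟩
    choose v hv using fun i => ZMod.ringHom_surjective (PadicInt.toZMod (p := p)) (w i)
    obtain rfl : PadicInt.toZMod ∘ v = w := funext hv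
    have hdet := (isUnit_leviDet hw).ne_zero
    rw [leviDet_map] at hdet
    obtain ⟨h, hh⟩ := exists_val_eq_siegelMat (isUnit_of_toZMod_ne_zero hdet)
    refine ⟨h, ⟨v, hh⟩, Units.ext ?_⟩
    rw [hw, ← siegelMat_map, ← hh]
    rfl

lemma blk_one_mul_emb (X g : Matrix (Fin 2) (Fin 2) ℚ_[p]) (hX : Xᵀ = X) (hg : g.det ≠ 0) :
    blk p 1 X 0 1 * emb p g =
      siegelMat ![X 0 0, X 0 1, X 1 1, g 0 0, g 0 1, g 1 0, g 1 1] := by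
  have hinv : g.det • (g⁻¹)ᵀ = (g.adjugate)ᵀ := by
    rw [Matrix.inv_def, Matrix.transpose_smul, smul_smul, Ring.inverse_eq_inv', mul_inv_cancel₀ hg,
      one_smul]
  have hX' : X 1 0 = X 0 1 := congrFun₂ hX 0 1
  have hmul : blk p 1 X 0 1 * emb p g = blk p g (X * (g.adjugate)ᵀ) 0 (g.adjugate)ᵀ := by
    simp only [emb, blk, hinv, Matrix.reindex_apply, Matrix.submatrix_mul_equiv,
      Matrix.fromBlocks_multiply]
    simp
  have hblk (A B C D : Matrix (Fin 2) (Fin 2) ℚ_[p]) : blk p A B C D =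
      !![A 0 0, A 0 1, B 0 0, B 0 1; A 1 0, A 1 1, B 1 0, B 1 1;
        C 0 0, C 0 1, D 0 0, D 0 1; C 1 0, C 1 1, D 1 0, D 1 1] := by
    ext i j
    fin_cases i <;> fin_cases j <;> rfl
  rw [hmul, hblk]
  ext i j
  fin_cases i <;> fin_cases j <;>
    simp [siegelMat, Matrix.mul_apply, Matrix.adjugate_fin_two, hX'] <;> ring

lemma UGL_eq_image : UGL p = padicIncl p '' siegelGroup ℤ_[p] := by
  ext m
  constructor
  · rintro ⟨_, ⟨X, hX, hXint, rfl⟩, g, ⟨hgint, hgdet⟩, rfl⟩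
    have hdet : g.det ≠ 0 := by
      rw [← norm_ne_zero_iff, hgdet]
      exact one_ne_zero
    let w : Fin 7 → ℚ_[p] := ![X 0 0, X 0 1, X 1 1, g 0 0, g 0 1, g 1 0, g 1 1]
    have hw (i) : ‖w i‖ ≤ 1 := by
      fin_cases i
      exacts [hXint 0 0, hXint 0 1, hXint 1 1, hgint 0 0, hgint 0 1, hgint 1 0, hgint 1 1]
    let v : Fin 7 → ℤ_[p] := fun i => ⟨w i, hw i⟩
    have hvw : PadicInt.Coe.ringHom ∘ v = w := rfl
    have hv : IsUnit (leviDet v) := by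
      rw [PadicInt.isUnit_iff, ← hgdet, Matrix.det_fin_two]
      rfl
    obtain ⟨h, hh⟩ := exists_val_eq_siegelMat hv
    refine ⟨h, ⟨v, hh⟩, ?_⟩
    rw [blk_one_mul_emb X g hX hdet, padicIncl_eq_map, hh, siegelMat_map, hvw]
  · rintro ⟨g, ⟨v, hv⟩, rfl⟩
    have hdet := PadicInt.isUnit_iff.mp (isUnit_leviDet hv)
    let X : Matrix (Fin 2) (Fin 2) ℚ_[p] := !![v 0, v 1; v 1, v 2]
    let A : Matrix (Fin 2) (Fin 2) ℚ_[p] := !![v 3, v 4; v 5, v 6]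
    have hA : A.det = (leviDet v : ℤ_[p]) := by simp [A, Matrix.det_fin_two, leviDet]
    have hAdet : ‖A.det‖ = 1 := by rw [hA]; exact hdet
    have hX : Xᵀ = X := by
      ext i j
      fin_cases i <;> fin_cases j <;> rfl
    refine ⟨_, ⟨X, hX, ?_, rfl⟩, A, ⟨?_, hAdet⟩, ?_⟩
    · intro i j
      fin_cases i <;> fin_cases j <;> exact PadicInt.norm_le_one _
    · intro i j
      fin_cases i <;> fin_cases j <;> exact PadicInt.norm_le_one _
    · rw [blk_one_mul_emb X A hX (by rw [← norm_ne_zero_iff, hAdet]; exact one_ne_zero),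
        padicIncl_eq_map, hv, siegelMat_map]
      congr 1
      funext i
      fin_cases i <;> rfl

lemma Gt1_eq_image {T : GL (Fin 4) ℤ_[p]} (hT : T ∈ similitudeGroup ℤ_[p]) :
    Gt1 p (padicIncl p T) =
      padicIncl p '' ((conjBorel (redGL T)).comap redGL ⊓ siegelGroup ℤ_[p] :
        Subgroup (GL (Fin 4) ℤ_[p])) := by
  have hconj (g : GL (Fin 4) ℤ_[p]) :
      (padicIncl p T)⁻¹ * padicIncl p g * padicIncl p T = padicIncl p (T⁻¹ * g * T) := by
    rw [inv_padicIncl, map_mul, map_mul]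
  have hIp {g : GL (Fin 4) ℤ_[p]} (hg : g ∈ siegelGroup ℤ_[p]) :
      padicIncl p (T⁻¹ * g * T) ∈ Ip p ↔ redGL g ∈ conjBorel (redGL T) := by
    rw [padicIncl_mem_Ip_iff (mul_mem (mul_mem (inv_mem hT)
      (siegelGroup_le_similitudeGroup hg)) hT), mem_conjBorel, map_mul, map_mul, map_inv]
    rfl
  have hcancel (g : GL (Fin 4) ℤ_[p]) :
      padicIncl p T * padicIncl p (T⁻¹ * g * T) * (padicIncl p T)⁻¹ = padicIncl p g := by
    rw [inv_padicIncl, ← map_mul, ← map_mul]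
    congr 1
    group
  ext x
  constructor
  · rintro ⟨_, ⟨⟨m, hm, rfl⟩, hy⟩, rfl⟩
    rw [UGL_eq_image] at hm
    obtain ⟨g, hg, rfl⟩ := hm
    rw [hconj] at hy ⊢
    exact ⟨g, ⟨(hIp hg).mp hy, hg⟩, (hcancel g).symm⟩
  · rintro ⟨g, ⟨hg, hgP⟩, rfl⟩
    refine ⟨padicIncl p (T⁻¹ * g * T), ⟨⟨padicIncl p g, ?_, (hconj g).symm⟩, (hIp hgP).mpr hg⟩,
      (hcancel g).symm⟩
    rw [UGL_eq_image]
    exact ⟨g, hgP, rfl⟩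

lemma indexGt1_padicIncl {T : GL (Fin 4) ℤ_[p]} (hT : T ∈ similitudeGroup ℤ_[p]) :
    indexGt1 p (padicIncl p T) =
      (conjBorel (redGL T)).relIndex (siegelGroup (ZMod p)) := by
  rw [indexGt1, Gt1_eq_image hT, UGL_eq_image,
    ncard_translates_eq_relIndex _ padicIncl_injective inf_le_right, Subgroup.inf_relIndex_right,
    Subgroup.relIndex_comap, map_siegelGroup]

lemma Jmat_mul_Umat_mul_Jmat (n r : ℤ_[p]) :
    Jmat p * Umat p n 0 r * Jmat p = padicIncl p (lowerUnit n r) := by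
  ext i j
  rw [padicIncl_apply]
  fin_cases i <;> fin_cases j <;>
    simp [Jmat, Umat, lowerUnit, Matrix.mul_apply, Fin.sum_univ_succ]

lemma Umat_zero_mul_Jmat : Umat p 0 0 0 * Jmat p = padicIncl p (sympUnit ℤ_[p]) := by
  ext i j
  rw [padicIncl_apply]
  fin_cases i <;> fin_cases j <;>
    simp [Jmat, Umat, sympUnit, sympMat, Matrix.mul_apply, Fin.sum_univ_succ]

lemma Zmat_zero : Zmat p 0 = 1 := by
  ext i j
  fin_cases i <;> fin_cases j <;> simp [Zmat]

lemma Zinf_eq : Zinf p = padicIncl p (swapUnit ℤ_[p]) := by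
  ext i j
  rw [padicIncl_apply]
  fin_cases i <;> fin_cases j <;> simp [Zinf, swapUnit]

variable (p)

theorem index_Gt1_determination :
    indexGt1 p (t1 p) = p * (p + 1) ∧
    indexGt1 p (t2 p) = p ^ 2 * (p + 1) ∧
    indexGt1 p (t3 p) = p ^ 2 * (p + 1) ∧
    indexGt1 p (t4 p) = p * (p + 1) ∧
    indexGt1 p (t5 p) = p + 1 ∧
    indexGt1 p (t6 p) = p + 1 ∧
    indexGt1 p (t7 p) = p ^ 3 * (p + 1) ∧
    indexGt1 p (t8 p) = p ^ 3 * (p + 1) := by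
  have hcard := ZMod.card p
  have h10 := Jmat_mul_Umat_mul_Jmat (p := p) 1 0
  have h01 := Jmat_mul_Umat_mul_Jmat (p := p) 0 1
  have h00 := Jmat_mul_Umat_mul_Jmat (p := p) 0 0
  rw [PadicInt.coe_one, PadicInt.coe_zero] at h10 h01
  rw [PadicInt.coe_zero] at h00
  refine ⟨?_, ?_, ?_, ?_, ?_, ?_, ?_, ?_⟩
  · rw [t1, h10, Zmat_zero, mul_one, indexGt1_padicIncl (lowerUnit_mem 1 0), redGL, map_lowerUnit,
      map_one, map_zero, relIndex_lower_one_zero, hcard, pow_one]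
  · rw [t2, h10, Zinf_eq, ← map_mul,
      indexGt1_padicIncl (mul_mem (lowerUnit_mem 1 0) swapUnit_mem), map_mul, redGL, map_lowerUnit,
      map_swapUnit, map_one, map_zero, relIndex_lower_one_zero_swap, hcard]
  · rw [t3, h01, Zmat_zero, mul_one, indexGt1_padicIncl (lowerUnit_mem 0 1), redGL, map_lowerUnit,
      map_one, map_zero, relIndex_lower_zero_one, hcard]
  · rw [t4, h01, Zinf_eq, ← map_mul,
      indexGt1_padicIncl (mul_mem (lowerUnit_mem 0 1) swapUnit_mem), map_mul, redGL, map_lowerUnit,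
      map_swapUnit, map_one, map_zero, relIndex_lower_zero_one_swap, hcard, pow_one]
  · rw [t5, h00, Zmat_zero, mul_one, indexGt1_padicIncl (lowerUnit_mem 0 0), redGL, map_lowerUnit,
      map_zero, relIndex_lower_zero_zero, hcard, pow_zero, one_mul]
  · rw [t6, h00, Zinf_eq, ← map_mul,
      indexGt1_padicIncl (mul_mem (lowerUnit_mem 0 0) swapUnit_mem), map_mul, redGL, map_lowerUnit,
      map_swapUnit, map_zero, relIndex_lower_zero_zero_swap, hcard, pow_zero, one_mul]
  · rw [t7, Umat_zero_mul_Jmat, Zmat_zero, mul_one, indexGt1_padicIncl sympUnit_mem, redGL,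
      map_sympUnit, relIndex_symp, hcard]
  · rw [t8, Umat_zero_mul_Jmat, Zinf_eq, ← map_mul,
      indexGt1_padicIncl (mul_mem sympUnit_mem swapUnit_mem), map_mul, redGL, map_sympUnit,
      map_swapUnit, relIndex_symp_swap, hcard]
end
end

section
/- Under the stated Bessel transformation property and the Hecke relations, for every integer l ≥ −1 and every integer m ≥ 0 the following hold: (i) if m > 0 then B(h(l,m)·t₇) + p·B(h(l,m)·t₈) = 0 and p·B(h(l,m)·t₅) + B(h(l,m)·t₆) = 0; (ii) p·B(h(l,m)·t₂) + B(h(l,m)·t₁) = 0 and p·B(h(l,m)·t₃) + B(h(l,m)·t₄) = 0; (iii) B(h(l,m)·t₇) = w_p·B(h(l+1,m)·t₆) and B(h(l,m)·t₈) = w_p·B(h(l+1,m)·t₅); (iv) B(h(l,m)·t₂) = w_p·ψ_p(p^{l−1}·c)·B(h(l−1, m+1)·t₃). -/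
open Matrix

noncomputable section

variable (p : ℕ) [Fact p.Prime]

/-- `Z_v` for `v ∈ V = Y ∪ {∞}`, where `Y = {0,…,p−1}` is modelled by `Fin p`
and `∞` by `none`. -/
def ZV : Option (Fin p) → Matrix (Fin 4) (Fin 4) ℚ_[p]
  | some y => Zmat p (y.val : ℚ_[p])
  | none => Zinf p

/-- Class A matrices `A_x^y = U_x · J · Z_y`. -/
def Amat (x : Fin p × Fin p × Fin p) (v : Option (Fin p)) : Matrix (Fin 4) (Fin 4) ℚ_[p] :=
  Umat p (x.1.val : ℚ_[p]) (x.2.1.val : ℚ_[p]) (x.2.2.val : ℚ_[p]) * Jmat p * ZV p v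

/-- Class B matrices `B_x^y = J · U_x · J · Z_y`. -/
def Bmat (x : Fin p × Fin p × Fin p) (v : Option (Fin p)) : Matrix (Fin 4) (Fin 4) ℚ_[p] :=
  Jmat p * Umat p (x.1.val : ℚ_[p]) (x.2.1.val : ℚ_[p]) (x.2.2.val : ℚ_[p]) * Jmat p * ZV p v

variable (a b c : ℚ_[p])

/-- The Atkin–Lehner element `η_p`. -/
def etamat : Matrix (Fin 4) (Fin 4) ℚ_[p] :=
  !![0,0,0,1; 0,0,1,0; 0,(p:ℚ_[p]),0,0; (p:ℚ_[p]),0,0,0]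

/-- `R_y` for `y ∈ V`: `R_y = (U_{(y,0,0)})ᵀ` for `y ∈ Y` and the given matrix for `y = ∞`. -/
def RV : Option (Fin p) → Matrix (Fin 4) (Fin 4) ℚ_[p]
  | some y => (Umat p (y.val : ℚ_[p]) 0 0)ᵀ
  | none => !![0,0,-1,0; 0,-1,0,0; -1,0,0,0; 0,0,0,1]

section Auxiliary

variable {p}

theorem hmat_eq (l : ℤ) (m : ℕ) :
    hmat p l m = !![((p : ℚ_[p]) ^ m) ^ 2 * (p : ℚ_[p]) ^ l, 0, 0, 0;
      0, (p : ℚ_[p]) ^ m * (p : ℚ_[p]) ^ l, 0, 0; 0, 0, 1, 0; 0, 0, 0, (p : ℚ_[p]) ^ m] := by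
  have hp : (p : ℚ_[p]) ≠ 0 := by exact_mod_cast (Fact.out : p.Prime).ne_zero
  have h1 : (p : ℚ_[p]) ^ (2 * (m : ℤ) + l) = ((p : ℚ_[p]) ^ m) ^ 2 * (p : ℚ_[p]) ^ l := by
    rw [zpow_add₀ hp, mul_comm 2 (m : ℤ), _root_.zpow_mul, zpow_natCast]
    norm_cast
  have h2 : (p : ℚ_[p]) ^ ((m : ℤ) + l) = (p : ℚ_[p]) ^ m * (p : ℚ_[p]) ^ l := by
    rw [zpow_add₀ hp, zpow_natCast]
  rw [hmat, h1, h2, zpow_natCast]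
  ext i j
  fin_cases i <;> fin_cases j <;> simp

theorem norm_zpow_le_one {n : ℤ} (hn : 0 ≤ n) : ‖(p : ℚ_[p]) ^ n‖ ≤ 1 := by
  lift n to ℕ using hn
  rw [zpow_natCast, norm_pow]
  exact pow_le_one₀ (norm_nonneg _) Padic.norm_p_lt_one.le

/-- The block diagonal matrix with a lower triangular and an upper triangular block. -/
def leviMat (x e y u f v : ℚ_[p]) : Matrix (Fin 4) (Fin 4) ℚ_[p] :=
  !![x, 0, 0, 0; e, y, 0, 0; 0, 0, u, f; 0, 0, 0, v]

theorem det_leviMat (x e y u f v : ℚ_[p]) : (leviMat x e y u f v).det = x * y * (u * v) := by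
  simp [leviMat, det_succ_row_zero, Fin.sum_univ_succ, Fin.succAbove]
  ring

theorem leviMat_mem_Ip {x e y u f v : ℚ_[p]} (hx : ‖x‖ = 1) (hy : ‖y‖ = 1) (hu : ‖u‖ = 1)
    (hv : ‖v‖ = 1) (he : ‖e‖ ≤ 1) (hf : ‖f‖ ≤ 1) (h : x * u = y * v) (h' : x * f + e * v = 0) :
    leviMat x e y u f v ∈ Ip p := by
  have hdet : ‖(leviMat x e y u f v).det‖ = 1 := by simp [det_leviMat, hx, hy, hu, hv]
  have hμ : x * u ≠ 0 := norm_ne_zero_iff.mp (by simp [hx, hu])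
  refine ⟨⟨⟨(norm_ne_zero_iff.mp (by simp [hdet])).isUnit, Units.mk0 _ hμ, ?_⟩, ?_, hdet⟩,
    ?_⟩
  · ext i j
    fin_cases i <;> fin_cases j <;>
      simp [leviMat, Jmat, Matrix.mul_apply, Fin.sum_univ_four] <;> grind
  · intro i j
    fin_cases i <;> fin_cases j <;> simp [leviMat, hx.le, hy.le, hu.le, hv.le, he, hf]
  · simp [leviMat]

theorem det_Umat (n q r : ℚ_[p]) : (Umat p n q r).det = 1 := by
  simp [Umat, det_succ_row_zero, Fin.sum_univ_succ, Fin.succAbove]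

theorem Umat_mem_Ip {n q r : ℚ_[p]} (hn : ‖n‖ ≤ 1) (hq : ‖q‖ ≤ 1) (hr : ‖r‖ ≤ 1) :
    Umat p n q r ∈ Ip p := by
  refine ⟨⟨⟨by simp [det_Umat], 1, ?_⟩, ?_, by simp [det_Umat]⟩, ?_⟩
  · ext i j
    fin_cases i <;> fin_cases j <;>
      simp [Umat, Jmat, Matrix.mul_apply, Fin.sum_univ_four]
  · intro i j
    fin_cases i <;> fin_cases j <;> simp [Umat, hn, hq, hr]
  · simp [Umat]

theorem one_mem_Ip : (1 : Matrix (Fin 4) (Fin 4) ℚ_[p]) ∈ Ip p := by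
  convert Umat_mem_Ip (p := p) (n := 0) (q := 0) (r := 0) (by simp) (by simp) (by simp) using 1
  ext i j
  fin_cases i <;> fin_cases j <;> simp [Umat]

theorem blk_one_eq_Umat (n q r : ℚ_[p]) : blk p 1 !![n, q; q, r] 0 1 = Umat p n q r := by
  ext i j
  fin_cases i <;> fin_cases j <;> simp [blk, Umat, fromBlocks, finSumFinEquiv, Fin.addCases]

theorem emb_one : emb p 1 = 1 := by
  ext i j
  fin_cases i <;> fin_cases j <;> simp [emb, blk, fromBlocks, finSumFinEquiv, Fin.addCases]

/-- The element `(1 + zb/2) + zξ` of the torus. -/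
def torusMat (a b c z : ℚ_[p]) : Matrix (Fin 2) (Fin 2) ℚ_[p] := !![1 + z * b, z * c; -(z * a), 1]

theorem torusMat_eq (a b c z : ℚ_[p]) :
    torusMat a b c z = (1 + z * b / 2) • (1 : Matrix (Fin 2) (Fin 2) ℚ_[p]) + z • xiS p a b c := by
  ext i j
  fin_cases i <;> fin_cases j <;> simp [torusMat, xiS] <;> ring

theorem det_torusMat (a b c z : ℚ_[p]) :
    (torusMat a b c z).det = 1 + z * b + z ^ 2 * a * c := by
  simp [torusMat, det_fin_two]
  ring

theorem torusMat_mem_Tgrp {a b c z : ℚ_[p]} (h : (torusMat a b c z).det ≠ 0) :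
    torusMat a b c z ∈ Tgrp p a b c := by
  refine ⟨h.isUnit, ?_⟩
  rw [det_torusMat]
  ext i j
  fin_cases i <;> fin_cases j <;>
    simp [torusMat, Smat, Matrix.mul_apply, Fin.sum_univ_two] <;> ring

theorem emb_torusMat {a b c z : ℚ_[p]} (h : (torusMat a b c z).det ≠ 0) :
    emb p (torusMat a b c z) = !![1 + z * b, z * c, 0, 0; -(z * a), 1, 0, 0;
      0, 0, 1, z * a; 0, 0, -(z * c), 1 + z * b] := by
  have hinv : (torusMat a b c z).det • ((torusMat a b c z)⁻¹)ᵀ =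
      !![1, z * a; -(z * c), 1 + z * b] := by
    rw [inv_def, Ring.inverse_eq_inv', transpose_smul, smul_smul, mul_inv_cancel₀ h, one_smul,
      torusMat, adjugate_fin_two]
    ext i j
    fin_cases i <;> fin_cases j <;> simp
  rw [emb, hinv]
  ext i j
  fin_cases i <;> fin_cases j <;>
    simp [torusMat, blk, fromBlocks, finSumFinEquiv, Fin.addCases]

theorem norm_one_add_eq_one {x : ℚ_[p]} (hx : ‖x‖ < 1) : ‖1 + x‖ = 1 := by
  rw [Padic.add_eq_max_of_ne (by simpa using hx.ne'), norm_one, max_eq_left hx.le]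

theorem norm_div_two_le_one {x : ℚ_[p]} (hx : ‖x‖ < 1) : ‖x / 2‖ ≤ 1 := by
  have hp : (0 : ℝ) < p := by exact_mod_cast (Fact.out : p.Prime).pos
  have hx' : ‖x‖ ≤ (p : ℝ)⁻¹ := by
    simpa using (Padic.norm_le_pow_iff_norm_lt_pow_add_one x (-1)).mpr (by simpa using hx)
  rw [norm_div]
  by_cases h : p ∣ 2
  · have h2 : (2 : ℚ_[p]) = (p : ℚ_[p]) := by
      exact_mod_cast ((Nat.prime_dvd_prime_iff_eq Fact.out Nat.prime_two).mp h).symm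
    rw [h2, Padic.norm_p]
    exact div_le_one_of_le₀ hx' (inv_nonneg.mpr hp.le)
  · have h2 : ‖(2 : ℚ_[p])‖ = 1 := by
      have h1 := mt Padic.norm_natCast_lt_one_iff.mp h
      exact le_antisymm (by exact_mod_cast Padic.norm_int_le_one (p := p) 2)
        (not_lt.mp (by exact_mod_cast h1))
    rw [h2, div_one]
    exact hx.le

/-- The Weyl element of the long root in the first coordinate. -/
def weylOne : Matrix (Fin 4) (Fin 4) ℚ_[p] :=
  !![0, 0, 1, 0; 0, 1, 0, 0; -1, 0, 0, 0; 0, 0, 0, 1]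

/-- The Weyl element of the long root in the second coordinate. -/
def weylTwo : Matrix (Fin 4) (Fin 4) ℚ_[p] :=
  !![1, 0, 0, 0; 0, 0, 0, 1; 0, 0, 1, 0; 0, -1, 0, 0]

theorem t5_eq : t5 p = leviMat (-1) 0 (-1) (-1) 0 (-1) := by
  ext i j
  fin_cases i <;> fin_cases j <;>
    simp [t5, leviMat, Jmat, Umat, Zmat, Matrix.mul_apply, Fin.sum_univ_four]

theorem t6_eq : t6 p = Zinf p * leviMat (-1) 0 (-1) (-1) 0 (-1) := by
  ext i j
  fin_cases i <;> fin_cases j <;>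
    simp [t6, leviMat, Jmat, Umat, Zinf, Matrix.mul_apply, Fin.sum_univ_four]

theorem t7_eq : t7 p = Jmat p := by
  ext i j
  fin_cases i <;> fin_cases j <;>
    simp [t7, Jmat, Umat, Zmat, Matrix.mul_apply, Fin.sum_univ_four]

theorem t8_eq : t8 p = Jmat p * Zinf p := by
  ext i j
  fin_cases i <;> fin_cases j <;>
    simp [t8, Jmat, Umat, Zinf, Matrix.mul_apply, Fin.sum_univ_four]

theorem t1_eq : t1 p = Umat p (-1) 0 0 * weylOne *
    (leviMat (-1) 0 (-1) (-1) 0 (-1) * Umat p (-1) 0 0) := by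
  ext i j
  fin_cases i <;> fin_cases j <;>
    simp [t1, leviMat, weylOne, Jmat, Umat, Zmat, Matrix.mul_apply, Fin.sum_univ_four]

theorem t2_eq : t2 p = Umat p (-1) 0 0 * (weylOne * Zinf p) *
    (leviMat (-1) 0 (-1) (-1) 0 (-1) * Umat p 0 0 (-1)) := by
  ext i j
  fin_cases i <;> fin_cases j <;>
    simp [t2, leviMat, weylOne, Jmat, Umat, Zinf, Matrix.mul_apply, Fin.sum_univ_four]

theorem t3_eq : t3 p = Umat p 0 0 (-1) * weylTwo *
    (leviMat (-1) 0 (-1) (-1) 0 (-1) * Umat p 0 0 (-1)) := by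
  ext i j
  fin_cases i <;> fin_cases j <;>
    simp [t3, leviMat, weylTwo, Jmat, Umat, Zmat, Matrix.mul_apply, Fin.sum_univ_four]

theorem t4_eq : t4 p = Umat p 0 0 (-1) * (weylTwo * Zinf p) *
    (leviMat (-1) 0 (-1) (-1) 0 (-1) * Umat p (-1) 0 0) := by
  ext i j
  fin_cases i <;> fin_cases j <;>
    simp [t4, leviMat, weylTwo, Jmat, Umat, Zinf, Matrix.mul_apply, Fin.sum_univ_four]

theorem neg_levi_mem_Ip : leviMat (-1) 0 (-1) (-1) 0 (-1) ∈ Ip p :=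
  leviMat_mem_Ip (by simp) (by simp) (by simp) (by simp) (by simp) (by simp) rfl (by simp)

theorem hmat_mul_Umat (l : ℤ) (m : ℕ) (n q r : ℚ_[p]) :
    hmat p l m * Umat p n q r = Umat p (((p : ℚ_[p]) ^ m) ^ 2 * (p : ℚ_[p]) ^ l * n)
      ((p : ℚ_[p]) ^ m * (p : ℚ_[p]) ^ l * q) ((p : ℚ_[p]) ^ l * r) * hmat p l m := by
  rw [hmat_eq]
  ext i j
  fin_cases i <;> fin_cases j <;>
    simp [Umat, Matrix.mul_apply, Fin.sum_univ_four] <;> ring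

theorem Zinf_mul_Zinf : Zinf p * Zinf p = 1 := by
  ext i j
  fin_cases i <;> fin_cases j <;> simp [Zinf, Matrix.mul_apply, Fin.sum_univ_four]

theorem weylOne_mul_Zinf_mul_Zmat (y : ℚ_[p]) :
    weylOne * Zinf p * Zmat p y = Umat p 0 (-y) 0 * (weylOne * Zinf p) := by
  ext i j
  fin_cases i <;> fin_cases j <;>
    simp [weylOne, Zinf, Zmat, Umat, Matrix.mul_apply, Fin.sum_univ_four]

theorem weylTwo_mul_Zmat (y : ℚ_[p]) :
    weylTwo * Zmat p y = Umat p 0 (-y) 0 * weylTwo := by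
  ext i j
  fin_cases i <;> fin_cases j <;>
    simp [weylTwo, Zmat, Umat, Matrix.mul_apply, Fin.sum_univ_four]

theorem Umat_mul_weylOne (r : ℚ_[p]) : Umat p 0 0 r * weylOne = weylOne * Umat p 0 0 r := by
  ext i j
  fin_cases i <;> fin_cases j <;> simp [weylOne, Umat, Matrix.mul_apply, Fin.sum_univ_four]

theorem Umat_mul_weylTwo (n : ℚ_[p]) : Umat p n 0 0 * weylTwo = weylTwo * Umat p n 0 0 := by
  ext i j
  fin_cases i <;> fin_cases j <;> simp [weylTwo, Umat, Matrix.mul_apply, Fin.sum_univ_four]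

theorem Umat_mul_Zinf (n q r : ℚ_[p]) : Umat p n q r * Zinf p = Zinf p * Umat p r q n := by
  ext i j
  fin_cases i <;> fin_cases j <;> simp [Zinf, Umat, Matrix.mul_apply, Fin.sum_univ_four]

theorem hmat_mul_Jmat_mul_etamat (l : ℤ) (m : ℕ) :
    hmat p l m * Jmat p * etamat p =
      hmat p (l + 1) m * t6 p * leviMat (-1) 0 (-1) 1 0 1 := by
  have hp : (p : ℚ_[p]) ≠ 0 := by exact_mod_cast (Fact.out : p.Prime).ne_zero
  rw [hmat_eq, hmat_eq, t6_eq, zpow_add_one₀ hp]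
  ext i j
  fin_cases i <;> fin_cases j <;>
    simp [etamat, leviMat, Jmat, Zinf, Matrix.mul_apply, Fin.sum_univ_four] <;> ring

theorem hmat_mul_Jmat_mul_Zinf_mul_etamat (l : ℤ) (m : ℕ) :
    hmat p l m * (Jmat p * Zinf p) * etamat p =
      hmat p (l + 1) m * t5 p * leviMat (-1) 0 (-1) 1 0 1 := by
  have hp : (p : ℚ_[p]) ≠ 0 := by exact_mod_cast (Fact.out : p.Prime).ne_zero
  rw [hmat_eq, hmat_eq, t5_eq, zpow_add_one₀ hp]
  ext i j
  fin_cases i <;> fin_cases j <;>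
    simp [etamat, leviMat, Jmat, Zinf, Matrix.mul_apply, Fin.sum_univ_four] <;> ring

theorem hmat_mul_weylOne_mul_Zinf_mul_etamat (l : ℤ) (m : ℕ) :
    hmat p l m * (weylOne * Zinf p) * etamat p =
      hmat p (l - 1) (m + 1) * weylTwo * leviMat 1 0 (-1) (-1) 0 1 := by
  have hp : (p : ℚ_[p]) ≠ 0 := by exact_mod_cast (Fact.out : p.Prime).ne_zero
  rw [hmat_eq, hmat_eq, zpow_sub_one₀ hp]
  ext i j
  fin_cases i <;> fin_cases j <;>
    simp [etamat, leviMat, weylOne, weylTwo, Zinf, Matrix.mul_apply, Fin.sum_univ_four] <;>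
    field_simp <;> ring

theorem emb_torusMat_mul_hmat {a b c z y : ℚ_[p]} {m : ℕ} (l : ℤ)
    (hz : z * c = (p : ℚ_[p]) ^ m * y) (h : (torusMat a b c z).det ≠ 0) :
    emb p (torusMat a b c z) * hmat p l m = hmat p l m * Zmat p y *
      leviMat (1 + z * b + (p : ℚ_[p]) ^ m * z * a * y) (-((p : ℚ_[p]) ^ m * z * a)) 1 1
        ((p : ℚ_[p]) ^ m * z * a) (1 + z * b + (p : ℚ_[p]) ^ m * z * a * y) := by
  rw [hmat_eq, emb_torusMat h]
  ext i j
  fin_cases i <;> fin_cases j <;>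
    simp [leviMat, Zmat, Matrix.mul_apply, Fin.sum_univ_four, hz] <;> ring

theorem leviMat_mul_Jmat_mul_Zinf (d e : ℚ_[p]) :
    leviMat d (-e) 1 1 e d * (Jmat p * Zinf p) =
      Jmat p * Zinf p * leviMat d e 1 1 (-e) d := by
  ext i j
  fin_cases i <;> fin_cases j <;>
    simp [leviMat, Jmat, Zinf, Matrix.mul_apply, Fin.sum_univ_four]

theorem Jmat_mul_Zinf_mul_Zmat (y : ℚ_[p]) :
    Jmat p * Zinf p * Zmat p y = Zmat p (-y) * (Jmat p * Zinf p) := by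
  ext i j
  fin_cases i <;> fin_cases j <;>
    simp [Jmat, Zinf, Zmat, Matrix.mul_apply, Fin.sum_univ_four]

theorem exists_torusMat_mul_hmat {a b c : ℚ_[p]} (ha : ‖a‖ ≤ 1) (hb : ‖b‖ ≤ 1) (hc : ‖c‖ = 1)
    (l : ℤ) {m : ℕ} (hm : 0 < m) {y : ℚ_[p]} (hy : ‖y‖ ≤ 1) :
    ∃ z d e : ℚ_[p], ‖z‖ < 1 ∧ ‖(torusMat a b c z).det‖ = 1 ∧ ‖d‖ = 1 ∧ ‖e‖ ≤ 1 ∧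
      emb p (torusMat a b c z) * hmat p l m = hmat p l m * Zmat p y * leviMat d (-e) 1 1 e d := by
  have hc0 : c ≠ 0 := norm_ne_zero_iff.mp (by simp [hc])
  have hpm : ‖(p : ℚ_[p]) ^ m‖ < 1 := by
    rw [norm_pow]
    exact pow_lt_one₀ (norm_nonneg _) Padic.norm_p_lt_one hm.ne'
  have mul_lt {u v : ℚ_[p]} (hu : ‖u‖ < 1) (hv : ‖v‖ ≤ 1) : ‖u * v‖ < 1 := by
    rw [norm_mul]
    exact mul_lt_one_of_nonneg_of_lt_one_left (norm_nonneg _) hu hv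
  have add_lt {u v : ℚ_[p]} (hu : ‖u‖ < 1) (hv : ‖v‖ < 1) : ‖u + v‖ < 1 :=
    (Padic.nonarchimedean u v).trans_lt (max_lt hu hv)
  set z := (p : ℚ_[p]) ^ m * (y / c) with hz
  have hyc : ‖y / c‖ ≤ 1 := by simpa [hc] using hy
  have hz1 : ‖z‖ < 1 := mul_lt hpm hyc
  have hzc : z * c = (p : ℚ_[p]) ^ m * y := by
    rw [hz]
    field_simp
  have hzb : ‖z * b‖ < 1 := mul_lt hz1 hb
  have he : ‖(p : ℚ_[p]) ^ m * z * a‖ < 1 := mul_lt (mul_lt hpm hz1.le) ha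
  have hdet : ‖(torusMat a b c z).det‖ = 1 := by
    rw [det_torusMat, add_assoc]
    refine norm_one_add_eq_one (add_lt hzb (mul_lt (mul_lt ?_ ha) hc.le))
    rw [sq]
    exact mul_lt hz1 hz1.le
  refine ⟨z, 1 + z * b + (p : ℚ_[p]) ^ m * z * a * y, (p : ℚ_[p]) ^ m * z * a, hz1, hdet, ?_, he.le,
    emb_torusMat_mul_hmat l hzc (norm_ne_zero_iff.mp (by simp [hdet]))⟩
  rw [add_assoc]
  exact norm_one_add_eq_one (add_lt hzb (mul_lt he hy))

section BesselFunction

variable {B : Matrix (Fin 4) (Fin 4) ℚ_[p] → ℂ} {ψ : ℚ_[p] → ℂ} {a b c : ℚ_[p]}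

theorem eq_zero_of_Umat_mul_eq
    (hU : ∀ n q r g, B (Umat p n q r * g) = ψ (a * n + b * q + c * r) * B g)
    (hK : ∀ g, ∀ k ∈ Ip p, B (g * k) = B g) {n q r : ℚ_[p]} {G k : Matrix (Fin 4) (Fin 4) ℚ_[p]}
    (hk : k ∈ Ip p) (h : Umat p n q r * G = G * k) (hψ : ψ (a * n + b * q + c * r) ≠ 1) :
    B G = 0 := by
  have h1 := hU n q r G
  rw [h, hK _ _ hk] at h1
  by_contra h0
  exact hψ (mul_right_cancel₀ h0 (by rw [one_mul, ← h1]))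

theorem mul_add_eq_zero_of_Zmat
    (hHZ : ∀ g : Matrix (Fin 4) (Fin 4) ℚ_[p], ∑ v : Option (Fin p), B (g * ZV p v) = 0)
    {G : Matrix (Fin 4) (Fin 4) ℚ_[p]} (h : ∀ y : ℚ_[p], ‖y‖ ≤ 1 → B (G * Zmat p y) = B G) :
    (p : ℂ) * B G + B (G * Zinf p) = 0 := by
  have h1 := hHZ G
  rw [Fintype.sum_option] at h1
  have h2 : ∀ y : Fin p, B (G * ZV p (some y)) = B G := fun y =>
    h _ (by exact_mod_cast Padic.norm_int_le_one (p := p) (y.val : ℤ))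
  simp only [h2, Finset.sum_const, Finset.card_univ, Fintype.card_fin, nsmul_eq_mul] at h1
  rw [add_comm]
  exact h1

end BesselFunction

end Auxiliary

theorem bessel_hecke_recursions
    (ha : ‖a‖ = 1) (hb : ‖b‖ ≤ 1) (hc : ‖c‖ = 1)
    (hd : ‖b ^ 2 - 4 * a * c‖ = 1)
    (hnsq : ∀ z : ℚ_[p], z ^ 2 ≠ b ^ 2 - 4 * a * c)
    (B : Matrix (Fin 4) (Fin 4) ℚ_[p] → ℂ) (ψ : ℚ_[p] → ℂ)
    (Λ : Matrix (Fin 2) (Fin 2) ℚ_[p] → ℂ)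
    (hψadd : ∀ x y : ℚ_[p], ψ (x + y) = ψ x * ψ y)
    (hψtriv : ∀ x : ℚ_[p], ‖x‖ ≤ 1 → ψ x = 1)
    (hψnontriv : ∃ x : ℚ_[p], ‖x‖ ≤ p ∧ ψ x ≠ 1)
    (hΛmul : ∀ s t, s ∈ Tgrp p a b c → t ∈ Tgrp p a b c → Λ (s * t) = Λ s * Λ t)
    (hΛne : ∀ t ∈ Tgrp p a b c, Λ t ≠ 0)
    (hΛscalar : ∀ z : ℚ_[p], z ≠ 0 → Λ (z • (1 : Matrix (Fin 2) (Fin 2) ℚ_[p])) = 1)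
    (hΛtriv : ∀ x y : ℚ_[p], ‖x‖ ≤ 1 → ‖y‖ < 1 →
      (x • (1 : Matrix (Fin 2) (Fin 2) ℚ_[p]) + y • xiS p a b c) ∈ GL2Z p →
      Λ (x • (1 : Matrix (Fin 2) (Fin 2) ℚ_[p]) + y • xiS p a b c) = 1)
    (hBessel : ∀ t ∈ Tgrp p a b c, ∀ X : Matrix (Fin 2) (Fin 2) ℚ_[p], Xᵀ = X →
      ∀ g : Matrix (Fin 4) (Fin 4) ℚ_[p], ∀ k ∈ Ip p,
      B (emb p t * blk p 1 X 0 1 * g * k) = Λ t * ψ ((Smat p a b c * X).trace) * B g)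
    (hB1 : B 1 = 1) (w : ℂ) (hw : w = 1 ∨ w = -1)
    (hHZ : ∀ g : Matrix (Fin 4) (Fin 4) ℚ_[p], ∑ v : Option (Fin p), B (g * ZV p v) = 0)
    (hHeta : ∀ g : Matrix (Fin 4) (Fin 4) ℚ_[p], B (g * etamat p) = w * B g)
    (hHR : ∀ g : Matrix (Fin 4) (Fin 4) ℚ_[p], ∑ v : Option (Fin p), B (g * RV p v) = 0) :
    ∀ l : ℤ, -1 ≤ l → ∀ m : ℕ,
      (0 < m →
        B (hmat p l m * t7 p) + (p : ℂ) * B (hmat p l m * t8 p) = 0 ∧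
        (p : ℂ) * B (hmat p l m * t5 p) + B (hmat p l m * t6 p) = 0) ∧
      ((p : ℂ) * B (hmat p l m * t2 p) + B (hmat p l m * t1 p) = 0 ∧
        (p : ℂ) * B (hmat p l m * t3 p) + B (hmat p l m * t4 p) = 0) ∧
      (B (hmat p l m * t7 p) = w * B (hmat p (l + 1) m * t6 p) ∧
        B (hmat p l m * t8 p) = w * B (hmat p (l + 1) m * t5 p)) ∧
      B (hmat p l m * t2 p) =
        w * ψ ((p : ℚ_[p]) ^ (l - 1) * c) * B (hmat p (l - 1) (m + 1) * t3 p) := by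
  have hp : (p : ℚ_[p]) ≠ 0 := by exact_mod_cast (Fact.out : p.Prime).ne_zero
  have hTone : (1 : Matrix (Fin 2) (Fin 2) ℚ_[p]) ∈ Tgrp p a b c := ⟨by simp, by simp⟩
  have hΛone : Λ 1 = 1 := by simpa using hΛscalar 1 one_ne_zero
  have hψzero : ψ 0 = 1 := hψtriv 0 (by simp)
  have hU : ∀ n q r g, B (Umat p n q r * g) = ψ (a * n + b * q + c * r) * B g := by
    intro n q r g
    have h := hBessel 1 hTone !![n, q; q, r]
      (by ext i j; fin_cases i <;> fin_cases j <;> simp) g 1 one_mem_Ip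
    rw [emb_one, one_mul, mul_one, blk_one_eq_Umat, hΛone, one_mul] at h
    rw [h]
    congr 2
    simp [trace, Smat, Fin.sum_univ_two]
    ring
  have hK : ∀ g, ∀ k ∈ Ip p, B (g * k) = B g := by
    intro g k hk
    have h := hBessel 1 hTone 0 (by simp) g k hk
    have hblk : blk p 1 0 0 1 = 1 := by simpa [emb] using emb_one (p := p)
    simpa [emb_one, hblk, hΛone, hψzero] using h
  have hT : ∀ z : ℚ_[p], ‖z‖ < 1 → ‖(torusMat a b c z).det‖ = 1 →
      ∀ g, B (emb p (torusMat a b c z) * g) = B g := by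
    intro z hz hdet g
    have hmem := torusMat_mem_Tgrp (norm_ne_zero_iff.mp (by simp [hdet] :
      ‖(torusMat a b c z).det‖ ≠ 0))
    have hint : ∀ u : ℚ_[p], ‖u‖ ≤ 1 → ‖z * u‖ ≤ 1 := fun u hu => by
      rw [norm_mul]
      exact mul_le_one₀ hz.le (norm_nonneg _) hu
    have hhalf : ‖z * b / 2‖ ≤ 1 := norm_div_two_le_one <| by
      rw [norm_mul]
      exact mul_lt_one_of_nonneg_of_lt_one_left (norm_nonneg _) hz hb
    have hGL : torusMat a b c z ∈ GL2Z p := by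
      refine ⟨fun i j => ?_, hdet⟩
      fin_cases i <;> fin_cases j
      · exact (Padic.nonarchimedean _ _).trans (max_le norm_one.le (hint b hb))
      · exact hint c hc.le
      · simpa [torusMat] using hint a ha.le
      · simp [torusMat]
    have hΛt : Λ (torusMat a b c z) = 1 := by
      rw [torusMat_eq] at hGL ⊢
      exact hΛtriv _ _ ((Padic.nonarchimedean _ _).trans (max_le (by simp) hhalf)) hz hGL
    have h := hBessel _ hmem 0 (by simp) g 1 one_mem_Ip
    have hblk : blk p 1 0 0 1 = 1 := by simpa [emb] using emb_one (p := p)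
    simpa [hblk, hΛt, hψzero] using h
  have hhU : ∀ (l : ℤ) (m : ℕ) (n q r : ℚ_[p]) g, B (hmat p l m * (Umat p n q r * g)) =
      ψ (a * ((p ^ m) ^ 2 * p ^ l * n) + b * (p ^ m * p ^ l * q) + c * (p ^ l * r)) *
        B (hmat p l m * g) := by
    intro l m n q r g
    rw [← mul_assoc, hmat_mul_Umat, mul_assoc, hU]
  have hneg : ∀ n q r : ℚ_[p], ‖n‖ ≤ 1 → ‖q‖ ≤ 1 → ‖r‖ ≤ 1 → ∀ g,
      B (g * (leviMat (-1) 0 (-1) (-1) 0 (-1) * Umat p n q r)) = B g := by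
    intro n q r hn hq hr g
    rw [← mul_assoc, hK _ _ (Umat_mem_Ip hn hq hr), hK _ _ neg_levi_mem_Ip]
  have ht1 : ∀ (l : ℤ) (m : ℕ), B (hmat p l m * t1 p) =
      ψ (-(a * ((p ^ m) ^ 2 * p ^ l))) * B (hmat p l m * weylOne) := by
    intro l m
    rw [t1_eq, ← mul_assoc, hneg _ _ _ (by simp) (by simp) (by simp), hhU]
    simp
  have ht2 : ∀ (l : ℤ) (m : ℕ), B (hmat p l m * t2 p) =
      ψ (-(a * ((p ^ m) ^ 2 * p ^ l))) * B (hmat p l m * (weylOne * Zinf p)) := by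
    intro l m
    rw [t2_eq, ← mul_assoc, hneg _ _ _ (by simp) (by simp) (by simp), hhU]
    simp
  have ht3 : ∀ (l : ℤ) (m : ℕ), B (hmat p l m * t3 p) =
      ψ (-(c * p ^ l)) * B (hmat p l m * weylTwo) := by
    intro l m
    rw [t3_eq, ← mul_assoc, hneg _ _ _ (by simp) (by simp) (by simp), hhU]
    simp
  have ht4 : ∀ (l : ℤ) (m : ℕ), B (hmat p l m * t4 p) =
      ψ (-(c * p ^ l)) * B (hmat p l m * (weylTwo * Zinf p)) := by
    intro l m
    rw [t4_eq, ← mul_assoc, hneg _ _ _ (by simp) (by simp) (by simp), hhU]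
    simp
  have hψnontriv' : ∀ u : ℚ_[p], ‖u‖ = 1 →
      ∃ x : ℚ_[p], ‖x‖ ≤ 1 ∧ ψ (u * (p ^ (-1 : ℤ) * x)) ≠ 1 := by
    intro u hu
    obtain ⟨x, hx, hx1⟩ := hψnontriv
    have hu0 : u ≠ 0 := norm_ne_zero_iff.mp (by simp [hu])
    refine ⟨p * x / u, ?_, ?_⟩
    · have hp' : (0 : ℝ) < p := by exact_mod_cast (Fact.out : p.Prime).pos
      rw [norm_div, norm_mul, hu, Padic.norm_p, div_one, inv_mul_le_iff₀ hp', mul_one]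
      exact hx
    · convert hx1 using 2
      rw [_root_.zpow_neg_one]
      field_simp
  have hint : ∀ (u : ℚ_[p]) (n : ℤ), ‖u‖ ≤ 1 → 0 ≤ n → ‖u * p ^ n‖ ≤ 1 := by
    intro u n hu hn
    rw [norm_mul]
    exact mul_le_one₀ hu (norm_nonneg _) (norm_zpow_le_one hn)
  have hpow : ∀ (m : ℕ) (l : ℤ), (p : ℚ_[p]) ^ m * p ^ l = p ^ (m + l) := by
    intro m l
    rw [zpow_add₀ hp, zpow_natCast]
  have hpow2 : ∀ (m : ℕ) (l : ℤ), ((p : ℚ_[p]) ^ m) ^ 2 * p ^ l = p ^ (2 * m + l) := by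
    intro m l
    rw [zpow_add₀ hp, ← pow_mul, ← zpow_natCast]
    congr 2
    push_cast
    ring
  have hone : ∀ m, B (hmat p (-1) m * weylOne) = 0 ∧
      B (hmat p (-1) m * (weylOne * Zinf p)) = 0 := by
    intro m
    obtain ⟨x, hx, hx1⟩ := hψnontriv' c hc
    constructor
    · refine eq_zero_of_Umat_mul_eq hU hK (n := 0) (q := 0) (r := p ^ (-1 : ℤ) * x)
        (Umat_mem_Ip (p := p) (n := 0) (q := 0) (by simp) (by simp) hx) ?_ (by simpa using hx1)
      rw [mul_assoc, ← Umat_mul_weylOne, ← mul_assoc, ← mul_assoc, hmat_mul_Umat]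
      simp
    · refine eq_zero_of_Umat_mul_eq hU hK (n := 0) (q := 0) (r := p ^ (-1 : ℤ) * x)
        (Umat_mem_Ip (p := p) (q := 0) (r := 0) hx (by simp) (by simp)) ?_ (by simpa using hx1)
      rw [mul_assoc, mul_assoc, ← Umat_mul_Zinf, ← mul_assoc weylOne, ← Umat_mul_weylOne,
        mul_assoc, ← mul_assoc, ← mul_assoc (hmat p _ m), hmat_mul_Umat]
      simp
  have htwo : B (hmat p (-1) 0 * weylTwo) = 0 ∧ B (hmat p (-1) 0 * (weylTwo * Zinf p)) = 0 := by
    obtain ⟨x, hx, hx1⟩ := hψnontriv' a ha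
    constructor
    · refine eq_zero_of_Umat_mul_eq hU hK (q := 0) (r := 0) (n := p ^ (-1 : ℤ) * x)
        (Umat_mem_Ip (p := p) (q := 0) (r := 0) hx (by simp) (by simp)) ?_ (by simpa using hx1)
      rw [mul_assoc, ← Umat_mul_weylTwo, ← mul_assoc, ← mul_assoc, hmat_mul_Umat]
      simp
    · refine eq_zero_of_Umat_mul_eq hU hK (q := 0) (r := 0) (n := p ^ (-1 : ℤ) * x)
        (Umat_mem_Ip (p := p) (n := 0) (q := 0) (by simp) (by simp) hx) ?_ (by simpa using hx1)
      rw [mul_assoc, mul_assoc, ← Umat_mul_Zinf, ← mul_assoc weylTwo, ← Umat_mul_weylTwo,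
        mul_assoc, ← mul_assoc, ← mul_assoc (hmat p _ 0), hmat_mul_Umat]
      simp
  have hby : ∀ y : ℚ_[p], ‖y‖ ≤ 1 → ‖b * -y‖ ≤ 1 := fun y hy => by
    rw [norm_mul, norm_neg]
    exact mul_le_one₀ hb (norm_nonneg _) hy
  have hwpm : ∀ {x y : ℂ}, w * x = y → x = w * y := by
    rintro x y rfl
    rcases hw with rfl | rfl <;> simp
  intro l hl m
  refine ⟨fun hm => ⟨?_, ?_⟩, ⟨?_, ?_⟩, ⟨?_, ?_⟩, ?_⟩
  · have h := mul_add_eq_zero_of_Zmat hHZ (G := hmat p l m * (Jmat p * Zinf p)) fun y hy => ?_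
    · rw [mul_assoc, mul_assoc (Jmat p), Zinf_mul_Zinf, mul_one] at h
      rw [t7_eq, t8_eq, add_comm]
      exact h
    · obtain ⟨z, d, e, hz, hdet, hd', he, h⟩ :=
        exists_torusMat_mul_hmat ha.le hb hc l hm (y := -y) (by simpa using hy)
      have hk : leviMat d e 1 1 (-e) d ∈ Ip p :=
        leviMat_mem_Ip hd' norm_one norm_one hd' he (by rwa [norm_neg]) (by ring) (by ring)
      rw [← hT z hz hdet (hmat p l m * (Jmat p * Zinf p)), ← mul_assoc (emb _ _), h,
        mul_assoc _ (leviMat _ _ _ _ _ _), leviMat_mul_Jmat_mul_Zinf,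
        ← mul_assoc _ _ (leviMat _ _ _ _ _ _), hK _ _ hk, mul_assoc, Jmat_mul_Zinf_mul_Zmat,
        mul_assoc]
  · have h := mul_add_eq_zero_of_Zmat hHZ (G := hmat p l m) fun y hy => ?_
    · rw [t5_eq, t6_eq, ← mul_assoc, hK _ _ neg_levi_mem_Ip, hK _ _ neg_levi_mem_Ip]
      exact h
    · obtain ⟨z, d, e, hz, hdet, hd', he, h⟩ := exists_torusMat_mul_hmat ha.le hb hc l hm hy
      have hk : leviMat d (-e) 1 1 e d ∈ Ip p :=
        leviMat_mem_Ip hd' norm_one norm_one hd' (by rwa [norm_neg]) he (by ring) (by ring)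
      rw [← hT z hz hdet (hmat p l m), h, hK _ _ hk]
  · rw [ht1, ht2]
    rcases hl.eq_or_lt with rfl | hl
    · simp [hone m]
    · have h := mul_add_eq_zero_of_Zmat hHZ (G := hmat p l m * (weylOne * Zinf p)) fun y hy => ?_
      · rw [mul_assoc, mul_assoc weylOne, Zinf_mul_Zinf, mul_one] at h
        linear_combination ψ (-(a * ((p ^ m) ^ 2 * p ^ l))) * h
      · rw [mul_assoc, weylOne_mul_Zinf_mul_Zmat, hhU, hψtriv, one_mul]
        have := hint (b * -y) (m + l) (hby y hy) (by omega)
        rw [hpow]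
        convert this using 2
        ring
  · rw [ht3, ht4]
    by_cases h0 : 0 ≤ m + l
    · have h := mul_add_eq_zero_of_Zmat hHZ (G := hmat p l m * weylTwo) fun y hy => ?_
      · rw [mul_assoc] at h
        linear_combination ψ (-(c * p ^ l)) * h
      · rw [mul_assoc, weylTwo_mul_Zmat, hhU, hψtriv, one_mul]
        have := hint (b * -y) (m + l) (hby y hy) h0
        rw [hpow]
        convert this using 2
        ring
    · obtain rfl : m = 0 := by omega
      obtain rfl : l = -1 := by omega
      simp [htwo]
  · apply hwpm
    rw [t7_eq, ← hHeta, hmat_mul_Jmat_mul_etamat, hK]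
    apply leviMat_mem_Ip <;> simp
  · apply hwpm
    rw [t8_eq, ← hHeta, hmat_mul_Jmat_mul_Zinf_mul_etamat, hK]
    apply leviMat_mem_Ip <;> simp
  · have h : B (hmat p l m * (weylOne * Zinf p)) = w * B (hmat p (l - 1) (m + 1) * weylTwo) := by
      apply hwpm
      rw [← hHeta, hmat_mul_weylOne_mul_Zinf_mul_etamat, hK]
      apply leviMat_mem_Ip <;> simp
    have hψc : ψ (p ^ (l - 1) * c) * ψ (-(c * p ^ (l - 1))) = 1 := by
      rw [← hψadd, mul_comm c, add_neg_cancel, hψzero]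
    have h' : B (hmat p l m * t2 p) = B (hmat p l m * (weylOne * Zinf p)) := by
      rw [ht2]
      rcases hl.eq_or_lt with rfl | hl
      · simp [hone m]
      · rw [hpow2, hψtriv, one_mul]
        rw [norm_neg]
        exact hint _ _ ha.le (by omega)
    rw [h', h, ht3]
    linear_combination -w * B (hmat p (l - 1) (m + 1) * weylTwo) * hψc
end
end
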